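/- arXiv:2001.03252 — 2 statements merged into one kernel-verified Lean document; each statement's English description precedes it below -/
import Mathlib

section
/- Let P = B ∪ R be a doubly collinear point set with |B| = |R| = n ≥ 1 such that the lines l_B and l_R are perpendicular. Then there exists a bichromatic perfect non-crossing matching of P minimizing the maximum edge length, and there exists a bichromatic perfect non-crossing matching of P maximizing the minimum edge length, each of the following form: for each of the four half-lines h and each half-line h' of the other color, the set of points of P ∩ h whose matching partner lies on h' is consecutive in the ordering of P ∩ h by distance to x (so each half-line is cut into two parts, and all points of a part are matched to points of the same opposite-color half-line). -/
noncomputable section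

open scoped InnerProductSpace

/-- The Euclidean plane. -/
abbrev Pt : Type := EuclideanSpace ℝ (Fin 2)

/-- The determinant of two plane vectors (twice the signed area). -/
def det2 (u v : Pt) : ℝ := u 0 * v 1 - u 1 * v 0

/-- The open half-line starting at `x` with direction `u`. -/
def halfLine (x u : Pt) : Set Pt := {y | ∃ t : ℝ, 0 < t ∧ y = x + t • u}

/-- The open half-line starting at `a` and passing through `c` (it contains `c`). -/
def rayThrough (a c : Pt) : Set Pt := {y | ∃ s : ℝ, 0 < s ∧ y = a + s • (c - a)}

/-- `σ` encodes a bichromatic perfect non-crossing matching of the blue points `B` and the red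
points `R`: it restricts to a bijection from `R` onto `B`, and the closed segments induced by
two distinct edges are disjoint. -/
def IsBM (B R : Finset Pt) (σ : Pt → Pt) : Prop :=
  Set.BijOn σ (↑R) (↑B) ∧
  (∀ r ∈ R, ∀ r' ∈ R, r ≠ r' →
    segment ℝ r (σ r) ∩ segment ℝ r' (σ r') = ∅)

/-- The bichromatic edge `{r, b}` is feasible: some bichromatic perfect non-crossing matching
of `B ∪ R` contains it. -/
def BFeasible (B R : Finset Pt) (r b : Pt) : Prop :=
  ∃ σ, IsBM B R σ ∧ σ r = b

/-- The subset `S` of `P ∩ h` is consecutive in the ordering of `P ∩ h` by distance to `x`: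
every point of `P ∩ h` lying (in that ordering) between two points of `S` belongs to `S`. -/
def ConsecOn (x : Pt) (P h S : Set Pt) : Prop :=
  ∀ a ∈ S, ∀ c ∈ S, ∀ p ∈ P ∩ h, dist x a ≤ dist x p → dist x p ≤ dist x c → p ∈ S

/-- The edge `{b, r}` lies in a small (acute) sector determined by the two lines through `x`
with directions `u` (blue) and `v` (red). -/
def InSmallSector (x u v b r : Pt) : Prop :=
  ∃ ε δ : ℝ, (ε = 1 ∨ ε = -1) ∧ (δ = 1 ∨ δ = -1) ∧
    0 < ⟪ε • u, δ • v⟫_ℝ ∧ b ∈ halfLine x (ε • u) ∧ r ∈ halfLine x (δ • v)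

/-- The edge `{b, r}` lies in a big (non-acute) sector determined by the two lines through `x`
with directions `u` (blue) and `v` (red). -/
def InBigSector (x u v b r : Pt) : Prop :=
  ∃ ε δ : ℝ, (ε = 1 ∨ ε = -1) ∧ (δ = 1 ∨ δ = -1) ∧
    ⟪ε • u, δ • v⟫_ℝ ≤ 0 ∧ b ∈ halfLine x (ε • u) ∧ r ∈ halfLine x (δ • v)

/-- The matching edge of the point `p` in the matching `σ` lies in a small sector. -/
def MatchedSmall (x u v : Pt) (R : Finset Pt) (σ : Pt → Pt) (p : Pt) : Prop :=
  ∃ r ∈ R, (p = r ∨ p = σ r) ∧ InSmallSector x u v (σ r) r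

/-- The matching edge of the point `p` in the matching `σ` lies in a big sector. -/
def MatchedBig (x u v : Pt) (R : Finset Pt) (σ : Pt → Pt) (p : Pt) : Prop :=
  ∃ r ∈ R, (p = r ∨ p = σ r) ∧ InBigSector x u v (σ r) r

/-- `q` is the matching partner of `p` in the matching `σ` (which maps red points to blue
points). -/
def IsPartner (R : Finset Pt) (σ : Pt → Pt) (p q : Pt) : Prop :=
  (p ∈ R ∧ q = σ p) ∨ (q ∈ R ∧ σ q = p)

/-- The structural form of Statement 15: for each half-line `h` (of direction `w`) and each
half-line `h'` of the other color (of direction `w'`), the set of points of `P ∩ h` whose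
matching partner lies on `h'` is consecutive in the ordering of `P ∩ h` by distance to `x`. -/
def Form15 (x u v : Pt) (B R : Finset Pt) (σ : Pt → Pt) : Prop :=
  ∀ w w' : Pt,
    (((w = u ∨ w = -u) ∧ (w' = v ∨ w' = -v)) ∨
     ((w = v ∨ w = -v) ∧ (w' = u ∨ w' = -u))) →
    ConsecOn x (↑B ∪ ↑R) (halfLine x w)
      {p | p ∈ (↑B ∪ ↑R : Set Pt) ∩ halfLine x w ∧
        ∃ q, IsPartner R σ p q ∧ q ∈ halfLine x w'}

/-- A finite set contains an initial segment, with respect to `f`, of every admissible size. -/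
theorem exists_lower_subset_card {α : Type*} [DecidableEq α] (H : Finset α) (f : α → ℝ)
    (hf : Set.InjOn f H) (k : ℕ) (hk : k ≤ H.card) :
    ∃ L ⊆ H, L.card = k ∧ ∀ a ∈ H, ∀ b ∈ L, f a ≤ f b → a ∈ L := by
  induction k with
  | zero => exact ⟨∅, by simp, by simp, by simp⟩
  | succ k ih =>
    obtain ⟨L, hLH, hLk, hL⟩ := ih (by omega)
    have hne : (H \ L).Nonempty := by
      rw [← Finset.card_pos, Finset.card_sdiff_of_subset hLH]
      omega
    obtain ⟨m, hm, hmin⟩ := Finset.exists_min_image (H \ L) f hne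
    rw [Finset.mem_sdiff] at hm
    refine ⟨insert m L, ?_, ?_, ?_⟩
    · exact Finset.insert_subset hm.1 hLH
    · rw [Finset.card_insert_of_notMem hm.2, hLk]
    · intro a ha b hb hab
      by_cases haL : a ∈ L
      · exact Finset.mem_insert_of_mem haL
      · rcases Finset.mem_insert.1 hb with rfl | hb
        · have h1 := hmin a (Finset.mem_sdiff.2 ⟨ha, haL⟩)
          rw [hf ha hm.1 (le_antisymm hab h1)]
          exact Finset.mem_insert_self _ _
        · exact absurd (hL a ha b hb hab) haL

/-- A labelling of a finite set by two labels can be rearranged so that both classes become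
consecutive, keep their sizes, and have no larger maximum. -/
theorem exists_consecutive_relabelling {α : Type*} [DecidableEq α] (H : Finset α) (f : α → ℝ)
    (hf : Set.InjOn f H) (l : α → Bool) :
    ∃ l' : α → Bool, (∀ d, (H.filter (fun y => l' y = d)).card =
        (H.filter (fun y => l y = d)).card) ∧
      (∀ y ∈ H, ∃ z ∈ H, l z = l' y ∧ f y ≤ f z) ∧
      (∀ a ∈ H, ∀ p ∈ H, ∀ c ∈ H, l' a = l' c → f a ≤ f p → f p ≤ f c → l' p = l' a) := by
  rcases H.eq_empty_or_nonempty with rfl | hne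
  · exact ⟨l, by simp, by simp, by simp⟩
  obtain ⟨m, hm, hmax⟩ := Finset.exists_max_image H f hne
  obtain ⟨L, hLH, hLk, hL⟩ := exists_lower_subset_card H f hf
    (H.filter (fun y => l y = !l m)).card (Finset.card_filter_le _ _)
  have hl' : ∀ y, (if y ∈ L then !l m else l m) = (!l m) ↔ y ∈ L := by
    intro y
    by_cases hy : y ∈ L <;> simp [hy]
  have hcard : ((H.filter (fun y => (if y ∈ L then !l m else l m) = !l m)).card =
        (H.filter (fun y => l y = !l m)).card) := by
    rw [← hLk]
    congr 1
    ext y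
    simp only [Finset.mem_filter, hl']
    exact ⟨fun h => h.2, fun h => ⟨hLH h, h⟩⟩
  refine ⟨fun y => if y ∈ L then !l m else l m, ?_, ?_, ?_⟩
  · intro d
    by_cases hd : d = !l m
    · rw [hd]
      exact hcard
    · have key : ∀ k : α → Bool, (H.filter (fun y => k y = d)).card =
          H.card - (H.filter (fun y => k y = !l m)).card := by
        intro k
        have h1 := Finset.card_filter_add_card_filter_not (s := H) (fun y => k y = !l m)
        have h2 : H.filter (fun y => ¬ k y = !l m) = H.filter (fun y => k y = d) := by
          apply Finset.filter_congr
          intro y _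
          cases hk : k y <;> cases hlm : l m <;> cases d <;> simp_all
        rw [h2] at h1
        omega
      rw [key, key l, hcard]
  · intro y hy
    by_cases hyL : y ∈ L
    · simp only [hyL, if_true]
      by_contra! hcon
      have hsub : H.filter (fun y => l y = !l m) ⊆ L.erase y := by
        intro z hz
        rw [Finset.mem_filter] at hz
        have h1 := hcon z hz.1 hz.2
        exact Finset.mem_erase.2 ⟨fun h => by simp [h] at h1, hL z hz.1 y hyL h1.le⟩
      have h1 := Finset.card_le_card hsub
      have h2 := Finset.card_erase_lt_of_mem hyL
      omega
    · exact ⟨m, hm, by simp [hyL], hmax y hy⟩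
  · intro a ha p hp c hc hac h1 h2
    by_cases haL : a ∈ L <;> by_cases hcL : c ∈ L <;> by_cases hpL : p ∈ L <;>
      simp [haL, hcL, hpL] at hac ⊢
    · exact hpL (hL p hp c hcL h2)
    · exact haL (hL a ha p hpL h1)

/-- The relabelling of `exists_consecutive_relabelling`, performed on both sides of a set. -/
theorem exists_consecutive_relabelling_sides {α : Type*} [DecidableEq α] (R : Finset α)
    (s : α → Bool) (f : α → ℝ)
    (hf : ∀ r ∈ R, ∀ r' ∈ R, s r = s r' → f r = f r' → r = r') (l : α → Bool) :
    ∃ l' : α → Bool, (∀ c d, (R.filter (fun y => s y = c ∧ l' y = d)).card =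
        (R.filter (fun y => s y = c ∧ l y = d)).card) ∧
      (∀ y ∈ R, ∃ z ∈ R, s z = s y ∧ l z = l' y ∧ f y ≤ f z) ∧
      (∀ a ∈ R, ∀ p ∈ R, ∀ c ∈ R, s a = s p → s a = s c → l' a = l' c →
        f a ≤ f p → f p ≤ f c → l' p = l' a) := by
  have h := fun c => exists_consecutive_relabelling (R.filter (fun y => s y = c)) f
    (by
      intro r hr r' hr' h
      simp only [Finset.coe_filter, Set.mem_ofPred_eq] at hr hr'
      exact hf r hr.1 r' hr'.1 (hr.2.trans hr'.2.symm) h) l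
  choose k hk1 hk2 hk3 using h
  refine ⟨fun y => k (s y) y, ?_, ?_, ?_⟩
  · intro c d
    have := hk1 c d
    rw [Finset.filter_filter, Finset.filter_filter] at this
    rw [← this]
    congr 1
    apply Finset.filter_congr
    rintro y -
    constructor
    · rintro ⟨rfl, h⟩
      exact ⟨rfl, h⟩
    · rintro ⟨rfl, h⟩
      exact ⟨rfl, h⟩
  · intro y hy
    obtain ⟨z, hz, h1, h2⟩ := hk2 (s y) y (by simp [hy])
    rw [Finset.mem_filter] at hz
    exact ⟨z, hz.1, hz.2, h1, h2⟩
  · intro a ha p hp c hc hap hac h h1 h2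
    simp only at h ⊢
    rw [← hac] at h
    rw [← hap]
    exact hk3 (s a) a (by simp [ha]) p (by simp [hp, hap]) c (by simp [hc, hac]) h h1 h2

/-- Two finite sets of the same size, ordered by injective keys, admit an increasing bijection. -/
theorem exists_increasing_bijOn {α β : Type*} [Nonempty β] (X : Finset α) (Y : Finset β)
    (f : α → ℝ) (g : β → ℝ) (hf : Set.InjOn f X) (hg : Set.InjOn g Y) (h : X.card = Y.card) :
    ∃ φ : α → β, Set.BijOn φ X Y ∧ ∀ r ∈ X, ∀ r' ∈ X, f r < f r' → g (φ r) < g (φ r') := by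
  classical
  let e₁ := (X.image f).orderIsoOfFin (Finset.card_image_of_injOn hf)
  let e₂ := (Y.image g).orderIsoOfFin ((Finset.card_image_of_injOn hg).trans h.symm)
  have hex : ∀ r, ∃ y, ∀ hr : r ∈ X, y ∈ Y ∧
      g y = e₂ (e₁.symm ⟨f r, Finset.mem_image_of_mem f hr⟩) := by
    intro r
    by_cases hr : r ∈ X
    · obtain ⟨y, hy, hy'⟩ := Finset.mem_image.1
        (e₂ (e₁.symm ⟨f r, Finset.mem_image_of_mem f hr⟩)).2
      exact ⟨y, fun _ => ⟨hy, hy'⟩⟩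
    · exact ⟨Classical.arbitrary β, fun h => absurd h hr⟩
  choose φ hφ using hex
  have hmono : ∀ r ∈ X, ∀ r' ∈ X, f r < f r' → g (φ r) < g (φ r') := by
    intro r hr r' hr' hlt
    rw [(hφ r hr).2, (hφ r' hr').2]
    exact_mod_cast e₂.strictMono (e₁.symm.strictMono (Subtype.mk_lt_mk.2 hlt))
  have hinj : Set.InjOn φ X := by
    intro r hr r' hr' he
    rcases lt_trichotomy (f r) (f r') with hlt | heq | hlt
    · exact absurd (hmono r hr r' hr' hlt) (by rw [he]; exact lt_irrefl _)
    · exact hf hr hr' heq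
    · exact absurd (hmono r' hr' r hr hlt) (by rw [he]; exact lt_irrefl _)
  have hmaps : Set.MapsTo φ X Y := fun r hr => (hφ r hr).1
  exact ⟨φ, ⟨hmaps, hinj, Finset.surjOn_of_injOn_of_card_le φ hmaps hinj h.symm.le⟩, hmono⟩

/-- Edges on the same pair of sides are nested: the order of the keys is preserved. -/
def IsNested {α β : Type*} (R : Finset α) (s : α → Bool) (t : β → Bool)
    (f : α → ℝ) (g : β → ℝ) (σ : α → β) : Prop :=
  ∀ r ∈ R, ∀ r' ∈ R, s r = s r' → t (σ r) = t (σ r') → f r < f r' → g (σ r) < g (σ r')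

/-- Every bijection can be turned into a nested one with consecutive parts, so that, if the
original one is nested, each new edge is dominated by an old edge. -/
theorem exists_nested_consecutive {α β : Type*} [DecidableEq α] [DecidableEq β]
    (R : Finset α) (B : Finset β)
    (s : α → Bool) (t : β → Bool) (f : α → ℝ) (g : β → ℝ)
    (hf : ∀ r ∈ R, ∀ r' ∈ R, s r = s r' → f r = f r' → r = r')
    (hg : ∀ b ∈ B, ∀ b' ∈ B, t b = t b' → g b = g b' → b = b')
    (σ : α → β) (hσ : Set.BijOn σ R B) :
    ∃ σ' : α → β, Set.BijOn σ' R B ∧ IsNested R s t f g σ' ∧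
      (∀ a ∈ R, ∀ p ∈ R, ∀ c ∈ R, s a = s p → s a = s c → t (σ' a) = t (σ' c) →
        f a ≤ f p → f p ≤ f c → t (σ' p) = t (σ' a)) ∧
      (∀ a ∈ R, ∀ p ∈ R, ∀ c ∈ R, t (σ' a) = t (σ' p) → t (σ' a) = t (σ' c) → s a = s c →
        g (σ' a) ≤ g (σ' p) → g (σ' p) ≤ g (σ' c) → s p = s a) ∧
      (IsNested R s t f g σ →
        ∀ r ∈ R, ∃ r₁ ∈ R, f r ≤ f r₁ ∧ g (σ' r) ≤ g (σ r₁)) := by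
  rcases R.eq_empty_or_nonempty with rfl | ⟨r₀, hr₀⟩
  · exact ⟨σ, hσ, by simp [IsNested], by simp, by simp, by simp⟩
  have : Nonempty α := ⟨r₀⟩
  have : Nonempty β := ⟨σ r₀⟩
  set τ := Function.invFunOn σ (R : Set α) with hτ
  have hinv : Set.InvOn τ σ R B := hσ.invOn_invFunOn
  have hτB : ∀ b ∈ B, τ b ∈ R := fun b hb => hσ.surjOn.mapsTo_invFunOn hb
  obtain ⟨l, hl1, hl2, hl3⟩ := exists_consecutive_relabelling_sides R s f hf (fun r => t (σ r))
  obtain ⟨k, hk1, hk2, hk3⟩ := exists_consecutive_relabelling_sides B t g hg (fun b => s (τ b))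
  have hcard : ∀ c d, (R.filter (fun y => s y = c ∧ l y = d)).card =
      (B.filter (fun y => t y = d ∧ k y = c)).card := by
    intro c d
    rw [hl1, hk1]
    apply Finset.card_bij' (fun r _ => σ r) (fun b _ => τ b)
    · intro r hr
      rw [Finset.mem_filter] at hr ⊢
      exact ⟨hσ.mapsTo hr.1, hr.2.2, by rw [hinv.1 hr.1]; exact hr.2.1⟩
    · intro b hb
      rw [Finset.mem_filter] at hb ⊢
      exact ⟨hτB b hb.1, hb.2.2, by rw [hinv.2 hb.1]; exact hb.2.1⟩
    · intro r hr
      exact hinv.1 (Finset.mem_filter.1 hr).1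
    · intro b hb
      exact hinv.2 (Finset.mem_filter.1 hb).1
  have hex := fun c d => exists_increasing_bijOn (R.filter (fun y => s y = c ∧ l y = d))
    (B.filter (fun y => t y = d ∧ k y = c)) f g
    (by
      intro r hr r' hr' h
      simp only [Finset.coe_filter, Set.mem_ofPred_eq] at hr hr'
      exact hf r hr.1 r' hr'.1 (hr.2.1.trans hr'.2.1.symm) h)
    (by
      intro r hr r' hr' h
      simp only [Finset.coe_filter, Set.mem_ofPred_eq] at hr hr'
      exact hg r hr.1 r' hr'.1 (hr.2.1.trans hr'.2.1.symm) h) (hcard c d)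
  choose φ hφ hφm using hex
  have hmemR : ∀ r ∈ R, r ∈ ((R.filter (fun y => s y = s r ∧ l y = l r) : Finset α) : Set α) := by
    intro r hr
    simp [hr]
  have hmem : ∀ r ∈ R, φ (s r) (l r) r ∈ B ∧ t (φ (s r) (l r) r) = l r ∧
      k (φ (s r) (l r) r) = s r := by
    intro r hr
    have := (hφ (s r) (l r)).mapsTo (hmemR r hr)
    simpa using this
  refine ⟨fun r => φ (s r) (l r) r, ⟨fun r hr => (hmem r hr).1, ?_, ?_⟩, ?_, ?_, ?_, ?_⟩
  · intro r hr r' hr' h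
    simp only at h
    have h1 : l r = l r' := by rw [← (hmem r hr).2.1, ← (hmem r' hr').2.1, h]
    have h2 : s r = s r' := by rw [← (hmem r hr).2.2, ← (hmem r' hr').2.2, h]
    refine (hφ (s r) (l r)).injOn (hmemR r hr) ?_ (by rw [h, h1, h2])
    rw [h1, h2]
    exact hmemR r' hr'
  · intro b hb
    obtain ⟨r, hr, hrb⟩ := (hφ (k b) (t b)).surjOn
      (show b ∈ _ by simpa using hb)
    simp only [Finset.coe_filter, Set.mem_ofPred_eq] at hr
    exact ⟨r, hr.1, by simp only [hr.2.1, hr.2.2, hrb]⟩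
  · intro r hr r' hr' h1 h2 h3
    simp only at h2 ⊢
    rw [(hmem r hr).2.1, (hmem r' hr').2.1] at h2
    have := hφm (s r) (l r) r (hmemR r hr) r' (by rw [h1, h2]; exact hmemR r' hr') h3
    rwa [← h1, ← h2]
  · intro a ha p hp c hc h1 h2 h3
    simp only at h3 ⊢
    rw [(hmem a ha).2.1, (hmem c hc).2.1] at h3
    rw [(hmem a ha).2.1, (hmem p hp).2.1]
    exact hl3 a ha p hp c hc h1 h2 h3
  · intro a ha p hp c hc h1 h2 h3 h4 h5
    have := hk3 _ (hmem a ha).1 _ (hmem p hp).1 _ (hmem c hc).1 h1 h2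
      (by rw [(hmem a ha).2.2, (hmem c hc).2.2, h3]) h4 h5
    rwa [(hmem a ha).2.2, (hmem p hp).2.2] at this
  · intro hnest r hr
    obtain ⟨z, hz, hz1, hz2, hz3⟩ := hl2 r hr
    obtain ⟨w, hw, hw1, hw2, hw3⟩ := hk2 _ (hmem r hr).1
    rw [(hmem r hr).2.1] at hw1
    rw [(hmem r hr).2.2] at hw2
    have hτw := hinv.2 hw
    rcases le_or_gt (f z) (f (τ w)) with h | h
    · exact ⟨τ w, hτB w hw, hz3.trans h, by rw [hτw]; exact hw3⟩
    · have := hnest (τ w) (hτB w hw) z hz (hw2.trans hz1.symm)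
        (by rw [hτw, hw1]; exact hz2.symm) h
      rw [hτw] at this
      exact ⟨z, hz, hz3, hw3.trans this.le⟩

/-- The coordinate of `p` along the direction `w`, with origin `x`. -/
def coord (x w p : Pt) : ℝ := ⟪w, p - x⟫_ℝ

theorem coord_add_smul (x w w' : Pt) (a : ℝ) : coord x w (x + a • w') = a * ⟪w, w'⟫_ℝ := by
  simp [coord, inner_smul_right]

theorem eq_add_coord_smul {x w p : Pt} (hw : ‖w‖ = 1) (h : ∃ t : ℝ, t ≠ 0 ∧ p = x + t • w) :
    coord x w p ≠ 0 ∧ p = x + coord x w p • w := by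
  obtain ⟨t, ht, rfl⟩ := h
  rw [coord_add_smul, real_inner_self_eq_norm_sq, hw]
  simp [ht]

theorem coord_eq_zero_of_perp {x w w' p : Pt} (h : ⟪w, w'⟫_ℝ = 0)
    (hp : ∃ t : ℝ, t ≠ 0 ∧ p = x + t • w') : coord x w p = 0 := by
  obtain ⟨t, -, rfl⟩ := hp
  rw [coord_add_smul, h, mul_zero]

theorem coord_ne_zero_of_mem_halfLine {x w w' p : Pt} (hw : ‖w‖ = 1) (hw' : w' = w ∨ w' = -w)
    (hp : p ∈ halfLine x w') : coord x w p ≠ 0 := by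
  obtain ⟨t, ht, rfl⟩ := hp
  rw [coord_add_smul]
  rcases hw' with rfl | rfl <;> simp [hw, ht.ne']

theorem exists_side_of_halfLine {x w w' : Pt} (hw : ‖w‖ = 1) (hw' : w' = w ∨ w' = -w) :
    ∃ d : Bool, ∀ p, (∃ t : ℝ, t ≠ 0 ∧ p = x + t • w) →
      (p ∈ halfLine x w' ↔ decide (0 < coord x w p) = d) := by
  have hww : ⟪w, w⟫_ℝ = 1 := by rw [real_inner_self_eq_norm_sq, hw]; norm_num
  rcases hw' with rfl | rfl
  · refine ⟨true, fun p hp => ?_⟩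
    obtain ⟨h0, h1⟩ := eq_add_coord_smul hw hp
    rw [decide_eq_true_iff]
    constructor
    · rintro ⟨t, ht, rfl⟩
      rwa [coord_add_smul, hww, mul_one]
    · exact fun h => ⟨_, h, h1⟩
  · refine ⟨false, fun p hp => ?_⟩
    obtain ⟨h0, h1⟩ := eq_add_coord_smul hw hp
    rw [decide_eq_false_iff_not]
    constructor
    · rintro ⟨t, ht, rfl⟩
      rw [coord_add_smul, inner_neg_right, hww]
      linarith
    · intro h
      refine ⟨-coord x w p, ?_, ?_⟩
      · have := lt_of_le_of_ne (not_lt.1 h) h0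
        linarith
      · rw [smul_neg, neg_smul, neg_neg]
        exact h1

theorem dist_eq_abs_coord {x w p : Pt} (hw : ‖w‖ = 1) (hp : ∃ t : ℝ, t ≠ 0 ∧ p = x + t • w) :
    dist x p = |coord x w p| := by
  conv_lhs => rw [(eq_add_coord_smul hw hp).2]
  rw [dist_eq_norm, sub_add_cancel_left, norm_neg, norm_smul, hw, mul_one, Real.norm_eq_abs]

section Perpendicular

variable {x u v : Pt}

theorem dist_perp (hu : ‖u‖ = 1) (hv : ‖v‖ = 1) (hperp : ⟪u, v⟫_ℝ = 0) (a b : ℝ) :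
    dist (x + a • v) (x + b • u) = √(a ^ 2 + b ^ 2) := by
  have huu : ⟪u, u⟫_ℝ = 1 := by rw [real_inner_self_eq_norm_sq, hu]; norm_num
  have hvv : ⟪v, v⟫_ℝ = 1 := by rw [real_inner_self_eq_norm_sq, hv]; norm_num
  have hvu : ⟪v, u⟫_ℝ = 0 := by rw [real_inner_comm]; exact hperp
  rw [dist_eq_norm, add_sub_add_left_eq_sub, norm_eq_sqrt_real_inner]
  simp only [inner_sub_left, inner_sub_right, inner_smul_left, inner_smul_right, huu, hvv, hperp,
    hvu, RCLike.conj_to_real]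
  congr 1
  ring

theorem dist_le_dist_of_abs_le (hu : ‖u‖ = 1) (hv : ‖v‖ = 1) (hperp : ⟪u, v⟫_ℝ = 0)
    {a b a' b' : ℝ} (ha : |a| ≤ |a'|) (hb : |b| ≤ |b'|) :
    dist (x + a • v) (x + b • u) ≤ dist (x + a' • v) (x + b' • u) := by
  rw [dist_perp hu hv hperp, dist_perp hu hv hperp]
  exact Real.sqrt_le_sqrt (add_le_add (sq_le_sq.2 ha) (sq_le_sq.2 hb))

theorem mem_segment_axes_iff (a b : ℝ) (p : Pt) :
    p ∈ segment ℝ (x + a • v) (x + b • u) ↔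
      ∃ s : ℝ, 0 ≤ s ∧ s ≤ 1 ∧ p = x + ((1 - s) * a) • v + (s * b) • u := by
  rw [segment_eq_image]
  constructor
  · rintro ⟨s, hs, rfl⟩
    exact ⟨s, hs.1, hs.2, by module⟩
  · rintro ⟨s, h0, h1, rfl⟩
    exact ⟨s, ⟨h0, h1⟩, by module⟩

/-- Two edges in the same quadrant that are not nested intersect. -/
theorem segment_inter_nonempty_of_not_nested {a b a' b' : ℝ}
    (ha : a ≠ 0) (hb : b ≠ 0) (hb' : b' ≠ 0)
    (hs : 0 < a ↔ 0 < a') (ht : 0 < b ↔ 0 < b') (h1 : |a| < |a'|) (h2 : |b'| ≤ |b|) :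
    (segment ℝ (x + a • v) (x + b • u) ∩ segment ℝ (x + a' • v) (x + b' • u)).Nonempty := by
  obtain ⟨k, hk, rfl⟩ : ∃ k : ℝ, 1 < k ∧ a' = k * a := by
    refine ⟨a' / a, ?_, by field_simp⟩
    rcases lt_or_gt_of_ne ha with h | h
    · have h' : a' ≤ 0 := not_lt.1 (fun h' => by linarith [hs.2 h'])
      rw [abs_of_neg h, abs_of_nonpos h'] at h1
      rw [lt_div_iff_of_neg h]
      linarith
    · rw [abs_of_pos h, abs_of_pos (hs.1 h)] at h1
      rw [lt_div_iff₀ h]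
      linarith
  obtain ⟨m, hm0, hm1, rfl⟩ : ∃ m : ℝ, 0 < m ∧ m ≤ 1 ∧ b' = m * b := by
    refine ⟨b' / b, ?_, ?_, by field_simp⟩
    · rcases lt_or_gt_of_ne hb with h | h
      · have h' : b' < 0 := lt_of_le_of_ne (not_lt.1 (fun h' => by linarith [ht.2 h'])) hb'
        exact div_pos_of_neg_of_neg h' h
      · exact div_pos (ht.1 h) h
    · rcases lt_or_gt_of_ne hb with h | h
      · have h' : b' ≤ 0 := not_lt.1 (fun h' => by linarith [ht.2 h'])
        rw [abs_of_neg h, abs_of_nonpos h'] at h2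
        rw [div_le_iff_of_neg h]
        linarith
      · rw [abs_of_pos h, abs_of_pos (ht.1 h)] at h2
        rw [div_le_iff₀ h]
        linarith
  have hkm : 0 < k - m := by linarith
  have hq0 : 0 ≤ (k - 1) / (k - m) := div_nonneg (by linarith) hkm.le
  have hq1 : (k - 1) / (k - m) ≤ 1 := (div_le_one hkm).2 (by linarith)
  refine ⟨x + ((1 - (k - 1) / (k - m) * m) * a) • v + ((k - 1) / (k - m) * m * b) • u, ?_, ?_⟩
  · exact (mem_segment_axes_iff _ _ _).2 ⟨_, mul_nonneg hq0 hm0.le,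
      mul_le_one₀ hq1 hm0.le hm1, rfl⟩
  · refine (mem_segment_axes_iff _ _ _).2 ⟨_, hq0, hq1, ?_⟩
    have e : (1 - (k - 1) / (k - m) * m) * a = (1 - (k - 1) / (k - m)) * (k * a) := by
      have := hkm.ne'
      field_simp
      ring
    rw [e, mul_assoc]

/-- Two vertex-disjoint edges that are nested or in different quadrants are disjoint. -/
theorem segment_inter_eq_empty_of_nested (hu : ‖u‖ = 1) (hv : ‖v‖ = 1) (hperp : ⟪u, v⟫_ℝ = 0)
    {a b a' b' : ℝ} (ha : a ≠ 0) (hb : b ≠ 0) (ha' : a' ≠ 0) (hb' : b' ≠ 0)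
    (haa : a ≠ a') (hbb : b ≠ b')
    (h : (0 < a ↔ 0 < a') → (0 < b ↔ 0 < b') →
      (|a| < |a'| ∧ |b| < |b'|) ∨ (|a'| < |a| ∧ |b'| < |b|)) :
    segment ℝ (x + a • v) (x + b • u) ∩ segment ℝ (x + a' • v) (x + b' • u) = ∅ := by
  have huu : ⟪u, u⟫_ℝ = 1 := by rw [real_inner_self_eq_norm_sq, hu]; norm_num
  have hvv : ⟪v, v⟫_ℝ = 1 := by rw [real_inner_self_eq_norm_sq, hv]; norm_num
  have hvu : ⟪v, u⟫_ℝ = 0 := by rw [real_inner_comm]; exact hperp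
  rw [Set.eq_empty_iff_forall_notMem]
  rintro p ⟨hp, hp'⟩
  obtain ⟨s, hs0, hs1, rfl⟩ := (mem_segment_axes_iff _ _ _).1 hp
  obtain ⟨t, ht0, ht1, he⟩ := (mem_segment_axes_iff _ _ _).1 hp'
  have e1 : (1 - s) * a = (1 - t) * a' := by
    have := congrArg (coord x v) he
    simpa [coord, add_assoc, inner_add_right, inner_smul_right, hvv, hvu, hv] using this
  have e2 : s * b = t * b' := by
    have := congrArg (coord x u) he
    simpa [coord, add_assoc, inner_add_right, inner_smul_right, huu, hperp, hu] using this
  have f1 : (1 - s) * |a| = (1 - t) * |a'| := by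
    have := congrArg abs e1
    rwa [abs_mul, abs_mul, abs_of_nonneg (sub_nonneg.2 hs1), abs_of_nonneg (sub_nonneg.2 ht1)]
      at this
  have f2 : s * |b| = t * |b'| := by
    have := congrArg abs e2
    rwa [abs_mul, abs_mul, abs_of_nonneg hs0, abs_of_nonneg ht0] at this
  have pa := abs_pos.2 ha
  have pa' := abs_pos.2 ha'
  have pb := abs_pos.2 hb
  have pb' := abs_pos.2 hb'
  have hs : s < 1 := by
    refine lt_of_le_of_ne hs1 fun h1 => ?_
    have h2 : t = 1 := by
      rw [h1, sub_self, zero_mul] at f1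
      rcases mul_eq_zero.1 f1.symm with h | h <;> linarith
    rw [h1, h2, one_mul, one_mul] at e2
    exact hbb e2
  have ht : t < 1 := by
    refine lt_of_le_of_ne ht1 fun h1 => ?_
    rw [h1, sub_self, zero_mul] at f1
    rcases mul_eq_zero.1 f1 with h | h <;> linarith
  have hs' : 0 < s := by
    refine lt_of_le_of_ne hs0 fun h1 => ?_
    have h2 : t = 0 := by
      rw [← h1, zero_mul] at f2
      rcases mul_eq_zero.1 f2.symm with h | h <;> linarith
    rw [← h1, h2, sub_zero, one_mul, one_mul] at e1
    exact haa e1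
  have ht' : 0 < t := by
    refine lt_of_le_of_ne ht0 fun h1 => ?_
    rw [← h1, zero_mul] at f2
    rcases mul_eq_zero.1 f2 with h | h <;> linarith
  have sa : 0 < a ↔ 0 < a' := by
    rw [← mul_pos_iff_of_pos_left (sub_pos.2 hs), e1, mul_pos_iff_of_pos_left (sub_pos.2 ht)]
  have sb : 0 < b ↔ 0 < b' := by
    rw [← mul_pos_iff_of_pos_left hs', e2, mul_pos_iff_of_pos_left ht']
  rcases h sa sb with ⟨h1, h2⟩ | ⟨h1, h2⟩
  · nlinarith [mul_lt_mul_of_pos_left h1 (sub_pos.2 ht), mul_lt_mul_of_pos_left h2 ht']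
  · nlinarith [mul_lt_mul_of_pos_left h1 (sub_pos.2 ht), mul_lt_mul_of_pos_left h2 ht']

variable {B R : Finset Pt}

/-- For perpendicular lines, the non-crossing matchings are the nested bijections. -/
theorem isBM_iff_isNested (hu : ‖u‖ = 1) (hv : ‖v‖ = 1) (hperp : ⟪u, v⟫_ℝ = 0)
    (hB : ∀ b ∈ B, ∃ t : ℝ, t ≠ 0 ∧ b = x + t • u)
    (hR : ∀ r ∈ R, ∃ t : ℝ, t ≠ 0 ∧ r = x + t • v) (σ : Pt → Pt) (hσ : Set.BijOn σ R B) :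
    IsBM B R σ ↔ IsNested R (fun r => decide (0 < coord x v r))
      (fun b => decide (0 < coord x u b)) (fun r => |coord x v r|) (fun b => |coord x u b|) σ := by
  constructor
  · rintro ⟨-, h⟩ r hr r' hr' hs ht hlt
    obtain ⟨r0, hr1⟩ := eq_add_coord_smul hv (hR r hr)
    obtain ⟨r0', hr1'⟩ := eq_add_coord_smul hv (hR r' hr')
    obtain ⟨b0, hb1⟩ := eq_add_coord_smul hu (hB _ (hσ.mapsTo hr))
    obtain ⟨b0', hb1'⟩ := eq_add_coord_smul hu (hB _ (hσ.mapsTo hr'))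
    by_contra hcon
    have hne := segment_inter_nonempty_of_not_nested (x := x) (u := u) (v := v) r0 b0 b0'
      (decide_eq_decide.1 hs) (decide_eq_decide.1 ht) hlt (not_lt.1 hcon)
    rw [← hr1, ← hr1', ← hb1, ← hb1'] at hne
    refine hne.ne_empty (h r hr r' hr' ?_)
    rintro rfl
    exact lt_irrefl _ hlt
  · intro h
    refine ⟨hσ, fun r hr r' hr' hne => ?_⟩
    obtain ⟨r0, hr1⟩ := eq_add_coord_smul hv (hR r hr)
    obtain ⟨r0', hr1'⟩ := eq_add_coord_smul hv (hR r' hr')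
    obtain ⟨b0, hb1⟩ := eq_add_coord_smul hu (hB _ (hσ.mapsTo hr))
    obtain ⟨b0', hb1'⟩ := eq_add_coord_smul hu (hB _ (hσ.mapsTo hr'))
    have haa : coord x v r ≠ coord x v r' := fun e => hne (by rw [hr1, hr1', e])
    have hbb : coord x u (σ r) ≠ coord x u (σ r') := fun e =>
      hne (hσ.injOn hr hr' (by rw [hb1, hb1', e]))
    have := segment_inter_eq_empty_of_nested (x := x) hu hv hperp r0 b0 r0' b0' haa hbb
      (fun hs ht => by
        rcases lt_trichotomy |coord x v r| |coord x v r'| with hlt | heq | hlt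
        · exact Or.inl ⟨hlt, h r hr r' hr' (decide_eq_decide.2 hs) (decide_eq_decide.2 ht) hlt⟩
        · rcases abs_eq_abs.1 heq with e | e
          · exact absurd e haa
          · exfalso
            rcases lt_or_gt_of_ne r0 with h1 | h1
            · have := hs.2 (by linarith)
              linarith
            · have := hs.1 h1
              linarith
        · exact Or.inr ⟨hlt, h r' hr' r hr (decide_eq_decide.2 hs.symm)
            (decide_eq_decide.2 ht.symm) hlt⟩)
    rwa [← hr1, ← hr1', ← hb1, ← hb1'] at this

theorem eq_of_abs_coord_eq {w p q : Pt} (hw : ‖w‖ = 1) (hp : ∃ t : ℝ, t ≠ 0 ∧ p = x + t • w)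
    (hq : ∃ t : ℝ, t ≠ 0 ∧ q = x + t • w)
    (hs : decide (0 < coord x w p) = decide (0 < coord x w q))
    (h : |coord x w p| = |coord x w q|) : p = q := by
  obtain ⟨p0, hp1⟩ := eq_add_coord_smul hw hp
  obtain ⟨q0, hq1⟩ := eq_add_coord_smul hw hq
  rw [decide_eq_decide] at hs
  rcases abs_eq_abs.1 h with e | e
  · rw [hp1, hq1, e]
  · exfalso
    rcases lt_or_gt_of_ne p0 with h1 | h1
    · have := hs.2 (by linarith)
      linarith
    · have := hs.1 h1
      linarith

/-- Consecutiveness of the parts, expressed in coordinates, yields `Form15`. -/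
theorem form15_of_consecutive (hu : ‖u‖ = 1) (hv : ‖v‖ = 1) (hperp : ⟪u, v⟫_ℝ = 0)
    (hB : ∀ b ∈ B, ∃ t : ℝ, t ≠ 0 ∧ b = x + t • u)
    (hR : ∀ r ∈ R, ∃ t : ℝ, t ≠ 0 ∧ r = x + t • v) (σ : Pt → Pt) (hσ : Set.BijOn σ R B)
    (s t : Pt → Bool) (hs : s = fun r => decide (0 < coord x v r))
    (ht : t = fun b => decide (0 < coord x u b))
    (h1 : ∀ a ∈ R, ∀ p ∈ R, ∀ c ∈ R, s a = s p → s a = s c → t (σ a) = t (σ c) →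
        |coord x v a| ≤ |coord x v p| → |coord x v p| ≤ |coord x v c| → t (σ p) = t (σ a))
    (h2 : ∀ a ∈ R, ∀ p ∈ R, ∀ c ∈ R, t (σ a) = t (σ p) → t (σ a) = t (σ c) → s a = s c →
        |coord x u (σ a)| ≤ |coord x u (σ p)| → |coord x u (σ p)| ≤ |coord x u (σ c)| →
        s p = s a) : Form15 x u v B R σ := by
  have hvu : ⟪v, u⟫_ℝ = 0 := by rw [real_inner_comm]; exact hperp
  rintro w w' (⟨hw, hw'⟩ | ⟨hw, hw'⟩)
  · obtain ⟨d, hd⟩ := exists_side_of_halfLine (x := x) hu hw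
    obtain ⟨d', hd'⟩ := exists_side_of_halfLine (x := x) hv hw'
    have hnot : ∀ p ∈ R, p ∉ halfLine x w := fun p hp hpw =>
      coord_ne_zero_of_mem_halfLine hu hw hpw (coord_eq_zero_of_perp hperp (hR p hp))
    have key : ∀ p ∈ halfLine x w, ∀ q, IsPartner R σ p q → q ∈ R ∧ σ q = p := by
      rintro p hp q (⟨hpR, -⟩ | hq)
      · exact absurd hp (hnot p hpR)
      · exact hq
    rintro a ⟨⟨-, haw⟩, qa, hqa, hqaw⟩ c ⟨⟨-, hcw⟩, qc, hqc, hqcw⟩ p ⟨hpP, hpw⟩ hap hpc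
    have hpB : p ∈ B := by
      rcases hpP with h | h
      · exact h
      · exact absurd hpw (hnot p h)
    obtain ⟨qp, hqp, rfl⟩ := hσ.surjOn hpB
    obtain ⟨hqaR, rfl⟩ := key a haw qa hqa
    obtain ⟨hqcR, rfl⟩ := key c hcw qc hqc
    have ma := hB _ (hσ.mapsTo hqaR)
    have mc := hB _ (hσ.mapsTo hqcR)
    have mp := hB _ hpB
    rw [dist_eq_abs_coord hu ma, dist_eq_abs_coord hu mp] at hap
    rw [dist_eq_abs_coord hu mc, dist_eq_abs_coord hu mp] at hpc
    rw [hd _ ma] at haw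
    rw [hd _ mc] at hcw
    rw [hd' _ (hR _ hqaR)] at hqaw
    rw [hd' _ (hR _ hqcR)] at hqcw
    refine ⟨⟨hpP, hpw⟩, qp, Or.inr ⟨hqp, rfl⟩, ?_⟩
    rw [hd _ mp] at hpw
    rw [hd' _ (hR _ hqp), ← hqaw]
    subst hs ht
    exact h2 qa hqaR qp hqp qc hqcR (haw.trans hpw.symm) (haw.trans hcw.symm)
      (hqaw.trans hqcw.symm) hap hpc
  · obtain ⟨d, hd⟩ := exists_side_of_halfLine (x := x) hv hw
    obtain ⟨d', hd'⟩ := exists_side_of_halfLine (x := x) hu hw'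
    have hnot : ∀ p ∈ B, p ∉ halfLine x w := fun p hp hpw =>
      coord_ne_zero_of_mem_halfLine hv hw hpw (coord_eq_zero_of_perp hvu (hB p hp))
    have key : ∀ p ∈ halfLine x w, ∀ q, IsPartner R σ p q → p ∈ R ∧ q = σ p := by
      rintro p hp q (hq | ⟨hqR, rfl⟩)
      · exact hq
      · exact absurd hp (hnot _ (hσ.mapsTo hqR))
    rintro a ⟨⟨-, haw⟩, qa, hqa, hqaw⟩ c ⟨⟨-, hcw⟩, qc, hqc, hqcw⟩ p ⟨hpP, hpw⟩ hap hpc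
    have hpR : p ∈ R := by
      rcases hpP with h | h
      · exact absurd hpw (hnot p h)
      · exact h
    obtain ⟨haR, rfl⟩ := key a haw qa hqa
    obtain ⟨hcR, rfl⟩ := key c hcw qc hqc
    have ma := hR _ haR
    have mc := hR _ hcR
    have mp := hR _ hpR
    rw [dist_eq_abs_coord hv ma, dist_eq_abs_coord hv mp] at hap
    rw [dist_eq_abs_coord hv mc, dist_eq_abs_coord hv mp] at hpc
    rw [hd _ ma] at haw
    rw [hd _ mc] at hcw
    rw [hd' _ (hB _ (hσ.mapsTo haR))] at hqaw
    rw [hd' _ (hB _ (hσ.mapsTo hcR))] at hqcw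
    refine ⟨⟨hpP, hpw⟩, σ p, Or.inl ⟨hpR, rfl⟩, ?_⟩
    rw [hd _ mp] at hpw
    rw [hd' _ (hB _ (hσ.mapsTo hpR)), ← hqaw]
    subst hs ht
    exact h1 a haR p hpR c hcR (haw.trans hpw.symm) (haw.trans hcw.symm)
      (hqaw.trans hqcw.symm) hap hpc

/-- Every bijection can be replaced by a structured non-crossing matching; if it is itself
non-crossing, each new edge is no longer than some old edge. -/
theorem exists_structured_dominated (hu : ‖u‖ = 1) (hv : ‖v‖ = 1) (hperp : ⟪u, v⟫_ℝ = 0)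
    (hB : ∀ b ∈ B, ∃ t : ℝ, t ≠ 0 ∧ b = x + t • u)
    (hR : ∀ r ∈ R, ∃ t : ℝ, t ≠ 0 ∧ r = x + t • v) (σ : Pt → Pt) (hσ : Set.BijOn σ R B) :
    ∃ σ', IsBM B R σ' ∧ Form15 x u v B R σ' ∧
      (IsBM B R σ → ∀ r ∈ R, ∃ r₁ ∈ R, dist r (σ' r) ≤ dist r₁ (σ r₁)) := by
  classical
  obtain ⟨σ', hσ', hn, h1, h2, hdom⟩ := exists_nested_consecutive R B
    (fun r => decide (0 < coord x v r)) (fun b => decide (0 < coord x u b))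
    (fun r => |coord x v r|) (fun b => |coord x u b|)
    (fun r hr r' hr' => eq_of_abs_coord_eq hv (hR r hr) (hR r' hr'))
    (fun b hb b' hb' => eq_of_abs_coord_eq hu (hB b hb) (hB b' hb')) σ hσ
  refine ⟨σ', (isBM_iff_isNested hu hv hperp hB hR σ' hσ').2 hn,
    form15_of_consecutive hu hv hperp hB hR σ' hσ' _ _ rfl rfl h1 h2, fun hBM r hr => ?_⟩
  obtain ⟨r₁, hr₁, ha, hb⟩ := hdom ((isBM_iff_isNested hu hv hperp hB hR σ hσ).1 hBM) r hr
  refine ⟨r₁, hr₁, ?_⟩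
  have := dist_le_dist_of_abs_le (x := x) hu hv hperp ha hb
  rwa [← (eq_add_coord_smul hv (hR _ hr)).2, ← (eq_add_coord_smul hv (hR _ hr₁)).2,
    ← (eq_add_coord_smul hu (hB _ (hσ'.mapsTo hr))).2,
    ← (eq_add_coord_smul hu (hB _ (hσ.mapsTo hr₁))).2] at this

/-- Every bijection can be replaced by a structured non-crossing matching; if it is itself
non-crossing, each new edge is no shorter than some old edge. -/
theorem exists_structured_dominating (hu : ‖u‖ = 1) (hv : ‖v‖ = 1) (hperp : ⟪u, v⟫_ℝ = 0)
    (hB : ∀ b ∈ B, ∃ t : ℝ, t ≠ 0 ∧ b = x + t • u)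
    (hR : ∀ r ∈ R, ∃ t : ℝ, t ≠ 0 ∧ r = x + t • v) (σ : Pt → Pt) (hσ : Set.BijOn σ R B) :
    ∃ σ', IsBM B R σ' ∧ Form15 x u v B R σ' ∧
      (IsBM B R σ → ∀ r ∈ R, ∃ r₁ ∈ R, dist r₁ (σ r₁) ≤ dist r (σ' r)) := by
  classical
  obtain ⟨σ', hσ', hn, h1, h2, hdom⟩ := exists_nested_consecutive R B
    (fun r => decide (0 < coord x v r)) (fun b => decide (0 < coord x u b))
    (fun r => -|coord x v r|) (fun b => -|coord x u b|)
    (fun r hr r' hr' hs h => eq_of_abs_coord_eq hv (hR r hr) (hR r' hr') hs (neg_inj.1 h))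
    (fun b hb b' hb' hs h => eq_of_abs_coord_eq hu (hB b hb) (hB b' hb') hs (neg_inj.1 h)) σ hσ
  refine ⟨σ', (isBM_iff_isNested hu hv hperp hB hR σ' hσ').2 ?_,
    form15_of_consecutive hu hv hperp hB hR σ' hσ' _ _ rfl rfl ?_ ?_, fun hBM r hr => ?_⟩
  · intro r hr r' hr' e1 e2 hlt
    exact neg_lt_neg_iff.1 (hn r' hr' r hr e1.symm e2.symm (neg_lt_neg hlt))
  · intro a ha p hp c hc e1 e2 e3 l1 l2
    exact (h1 c hc p hp a ha (e2.symm.trans e1) e2.symm e3.symm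
      (neg_le_neg l2) (neg_le_neg l1)).trans e3.symm
  · intro a ha p hp c hc e1 e2 e3 l1 l2
    exact (h2 c hc p hp a ha (e2.symm.trans e1) e2.symm e3.symm
      (neg_le_neg l2) (neg_le_neg l1)).trans e3.symm
  · have hn' := (isBM_iff_isNested hu hv hperp hB hR σ hσ).1 hBM
    obtain ⟨r₁, hr₁, ha, hb⟩ := hdom (fun r hr r' hr' e1 e2 hlt =>
      neg_lt_neg (hn' r' hr' r hr e1.symm e2.symm (neg_lt_neg_iff.1 hlt))) r hr
    refine ⟨r₁, hr₁, ?_⟩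
    have := dist_le_dist_of_abs_le (x := x) hu hv hperp (neg_le_neg_iff.1 ha)
      (neg_le_neg_iff.1 hb)
    rwa [← (eq_add_coord_smul hv (hR _ hr)).2, ← (eq_add_coord_smul hv (hR _ hr₁)).2,
      ← (eq_add_coord_smul hu (hB _ (hσ'.mapsTo hr))).2,
      ← (eq_add_coord_smul hu (hB _ (hσ.mapsTo hr₁))).2] at this

end Perpendicular

/-- A functional of matchings whose value is always an edge length takes finitely many values. -/
theorem finite_image_matchings (B R : Finset Pt) (F : (Pt → Pt) → ℝ)
    (hF : ∀ σ, ∃ r ∈ R, F σ = dist r (σ r)) : (F '' {σ | IsBM B R σ}).Finite := by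
  refine ((R ×ˢ B).finite_toSet.image fun q => dist q.1 q.2).subset ?_
  rintro _ ⟨σ, hσ, rfl⟩
  obtain ⟨r, hr, h⟩ := hF σ
  exact ⟨(r, σ r), by simpa using ⟨hr, hσ.1.mapsTo hr⟩, h.symm⟩

/-- Let `P = B ∪ R` be a doubly collinear point set with `|B| = |R| = n ≥ 1`
whose two lines are perpendicular. Then there is a matching minimizing the maximum edge length,
and a matching maximizing the minimum edge length, each of the following form: for each
half-line `h` and each half-line `h'` of the other color, the set of points of `P ∩ h` matched
to points of `h'` is consecutive in the ordering by distance to `x`. -/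
theorem dc_perpendicular_structured_optima (n : ℕ) (hn : 1 ≤ n)
    (x u v : Pt) (hu : ‖u‖ = 1) (hv : ‖v‖ = 1) (hperp : ⟪u, v⟫_ℝ = 0) (B R : Finset Pt)
    (hB : ∀ b ∈ B, ∃ t : ℝ, t ≠ 0 ∧ b = x + t • u)
    (hR : ∀ r ∈ R, ∃ t : ℝ, t ≠ 0 ∧ r = x + t • v)
    (hcB : B.card = n) (hcR : R.card = n) (hRne : R.Nonempty) :
    (∃ σ, IsBM B R σ ∧
      (∀ σ', IsBM B R σ' →
        R.sup' hRne (fun r => dist r (σ r)) ≤ R.sup' hRne (fun r => dist r (σ' r))) ∧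
      Form15 x u v B R σ) ∧
    (∃ σ, IsBM B R σ ∧
      (∀ σ', IsBM B R σ' →
        R.inf' hRne (fun r => dist r (σ' r)) ≤ R.inf' hRne (fun r => dist r (σ r))) ∧
      Form15 x u v B R σ) := by
  classical
  obtain ⟨σ₀, hσ₀⟩ := R.finite_toSet.exists_bijOn_of_encard_eq (t := (B : Set Pt))
    (by simp [hcB, hcR])
  obtain ⟨σ₁, hσ₁, -⟩ := exists_structured_dominated hu hv hperp hB hR σ₀ hσ₀
  have hne : {σ | IsBM B R σ}.Nonempty := ⟨σ₁, hσ₁⟩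
  constructor
  · obtain ⟨_, ⟨σ, hσ, rfl⟩, hmin⟩ := Set.exists_min_image _ id
      (finite_image_matchings B R (fun σ => R.sup' hRne (fun r => dist r (σ r)))
        (fun σ => R.exists_mem_eq_sup' hRne _)) (hne.image _)
    obtain ⟨σ', hσ', hform, hdom⟩ := exists_structured_dominated hu hv hperp hB hR σ hσ.1
    refine ⟨σ', hσ', fun τ hτ => le_trans ?_ (hmin _ ⟨τ, hτ, rfl⟩), hform⟩
    refine Finset.sup'_le _ _ fun r hr => ?_
    obtain ⟨r₁, hr₁, h⟩ := hdom hσ r hr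
    exact h.trans (Finset.le_sup' (fun r => dist r (σ r)) hr₁)
  · obtain ⟨_, ⟨σ, hσ, rfl⟩, hmax⟩ := Set.exists_max_image _ id
      (finite_image_matchings B R (fun σ => R.inf' hRne (fun r => dist r (σ r)))
        (fun σ => R.exists_mem_eq_inf' hRne _)) (hne.image _)
    obtain ⟨σ', hσ', hform, hdom⟩ := exists_structured_dominating hu hv hperp hB hR σ hσ.1
    refine ⟨σ', hσ', fun τ hτ => le_trans (hmax _ ⟨τ, hτ, rfl⟩) ?_, hform⟩
    refine Finset.le_inf' _ _ fun r hr => ?_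
    obtain ⟨r₁, hr₁, h⟩ := hdom hσ r hr
    exact (Finset.inf'_le (fun r => dist r (σ r)) hr₁).trans h
end
end

section
/- Let P = B ∪ R be a doubly collinear point set with |B| = |R| = n ≥ 1 such that the acute angle between the lines l_B and l_R is at most π/4. Then there exists a bichromatic perfect non-crossing matching M of P minimizing the maximum edge length among all bichromatic perfect non-crossing matchings of P and of the following form: for each of the four half-lines h, the points of P ∩ h whose matching edge in M lies in a big sector form an initial segment (the points closest to x) of the ordering of P ∩ h by distance to x, and the points of P ∩ h whose matching edge lies in a small sector form the complementary final segment. -/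
noncomputable section

open scoped InnerProductSpace

/-- The squared length of the edge joining the points with coordinates `s` and `t` on two lines
whose unit directions have inner product `c`. -/
def sqLen (c s t : ℝ) : ℝ := s ^ 2 + t ^ 2 - 2 * c * s * t

/-- The edges with coordinates `(s, t)` and `(s', t')` lie in a common sector and are nested in
opposite order on its two sides. -/
def Cross (s t s' t' : ℝ) : Prop :=
  0 < s * s' ∧ 0 < t * t' ∧ (|s| - |s'|) * (|t| - |t'|) < 0

/-- The matching with edges `(β (π i), ρ i)` has no crossing. -/
def NonCrossing {ι : Type*} (β ρ : ι → ℝ) (π : Equiv.Perm ι) : Prop :=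
  ∀ i j, i ≠ j → ¬ Cross (β (π i)) (ρ i) (β (π j)) (ρ j)

/-- The total distance to the intersection point of all the points matched in a big sector. -/
def bigWeight {ι : Type*} [Fintype ι] (β ρ : ι → ℝ) (π : Equiv.Perm ι) : ℝ :=
  ∑ i, if β (π i) * ρ i < 0 then |β (π i)| + |ρ i| else 0

lemma sqLen_comm (c s t : ℝ) : sqLen c s t = sqLen c t s := by
  unfold sqLen; ring

lemma sqLen_neg_neg (c s t : ℝ) : sqLen c (-s) (-t) = sqLen c s t := by
  unfold sqLen; ring

lemma Cross.swap {s t s' t' : ℝ} (h : Cross s t s' t') : Cross t s t' s' :=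
  ⟨h.2.1, h.1, by rw [mul_comm]; exact h.2.2⟩

lemma Cross.symm {s t s' t' : ℝ} (h : Cross s t s' t') : Cross s' t' s t :=
  ⟨by rw [mul_comm]; exact h.1, by rw [mul_comm]; exact h.2.1, by linarith [h.2.2]⟩

lemma NonCrossing.symm {ι : Type*} {β ρ : ι → ℝ} {π : Equiv.Perm ι} (h : NonCrossing β ρ π) :
    NonCrossing ρ β π.symm := by
  intro i j hij hc
  refine h (π.symm i) (π.symm j) (fun e => hij (π.symm.injective e)) ?_
  simpa using hc.swap

lemma bigWeight_symm {ι : Type*} [Fintype ι] (β ρ : ι → ℝ) (π : Equiv.Perm ι) :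
    bigWeight ρ β π.symm = bigWeight β ρ π := by
  unfold bigWeight
  rw [← Equiv.sum_comp π]
  refine Finset.sum_congr rfl fun i _ => ?_
  simp only [Equiv.symm_apply_apply, mul_comm (ρ i), add_comm |ρ i|]

/-- Some matching is non-crossing, namely the one maximizing the sum of the products of the
distances to the intersection point. -/
lemma exists_nonCrossing {ι : Type*} [Finite ι] (β ρ : ι → ℝ) :
    ∃ π : Equiv.Perm ι, NonCrossing β ρ π := by
  classical
  have := Fintype.ofFinite ι
  obtain ⟨π, hπ⟩ := Finite.exists_max (fun π : Equiv.Perm ι => ∑ i, |β (π i)| * |ρ i|)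
  refine ⟨π, fun i j hij hc => ?_⟩
  have h := hπ (π * Equiv.swap i j)
  have hsplit : ∀ f : ι → ℝ, ∑ k, f k = f i + f j + ∑ k ∈ {i, j}ᶜ, f k := fun f => by
    rw [← Finset.sum_add_sum_compl {i, j} f, Finset.sum_pair hij]
  simp only [hsplit, Equiv.Perm.mul_apply, Equiv.swap_apply_left, Equiv.swap_apply_right] at h
  have hrest : ∑ k ∈ {i, j}ᶜ, |β (π (Equiv.swap i j k))| * |ρ k|
      = ∑ k ∈ {i, j}ᶜ, |β (π k)| * |ρ k| := by
    refine Finset.sum_congr rfl fun k hk => ?_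
    simp only [Finset.mem_compl, Finset.mem_insert, Finset.mem_singleton, not_or] at hk
    rw [Equiv.swap_apply_of_ne_of_ne hk.1 hk.2]
  rw [hrest] at h
  linarith [hc.2.2]

lemma sqLen_le_of_swap_of_pos {c s s' t t' : ℝ} (hc : 0 ≤ c) (hc2 : 1 / 2 ≤ c ^ 2) (hs : 0 < s)
    (hss : s < s') (ht : 0 < t) (ht' : t' < 0) :
    sqLen c s' t ≤ sqLen c s t ∨ sqLen c s' t ≤ sqLen c s' t' := by
  unfold sqLen
  by_contra! h
  obtain ⟨h1, h2⟩ := h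
  have h3 : 2 * c * t < s + s' := by
    by_contra! h3
    nlinarith [mul_nonneg (sub_nonneg.2 hss.le) (sub_nonneg.2 h3)]
  have h4 : 2 * c * s' < t := by
    by_contra! h4
    nlinarith [mul_nonneg ht.le (sub_nonneg.2 h4),
      mul_nonneg (mul_nonneg hc (hs.trans hss).le) (neg_nonneg.2 ht'.le)]
  nlinarith [mul_le_mul_of_nonneg_left h4.le hc]

/-- Exchanging a closer small-sector endpoint `s` with a farther big-sector endpoint `s'`:
the new small-sector edge is no longer than one of the old edges. -/
lemma sqLen_le_of_swap {c s s' t t' : ℝ} (hc : 0 ≤ c) (hc2 : 1 / 2 ≤ c ^ 2) (hs : 0 < s * s')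
    (hss : |s| < |s'|) (ht : 0 < s * t) (ht' : s' * t' < 0) :
    sqLen c s' t ≤ sqLen c s t ∨ sqLen c s' t ≤ sqLen c s' t' := by
  rcases mul_pos_iff.1 hs with ⟨h1, h2⟩ | ⟨h1, h2⟩
  · rw [abs_of_pos h1, abs_of_pos h2] at hss
    exact sqLen_le_of_swap_of_pos hc hc2 h1 hss (pos_of_mul_pos_right ht h1.le) (by nlinarith)
  · rw [abs_of_neg h1, abs_of_neg h2] at hss
    simp only [← sqLen_neg_neg c s', ← sqLen_neg_neg c s]
    exact sqLen_le_of_swap_of_pos hc hc2 (by linarith) hss (by nlinarith) (by nlinarith)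

/-- The new big-sector edge is no longer than the old one. -/
lemma sqLen_le_of_abs_le {c s s' t : ℝ} (hc : 0 ≤ c) (hs : 0 < s * s') (hss : |s| ≤ |s'|)
    (ht : s' * t < 0) : sqLen c s t ≤ sqLen c s' t := by
  unfold sqLen
  have h1 : s ^ 2 ≤ s' ^ 2 := sq_le_sq.2 hss
  have h2 : s' * t ≤ s * t := by
    rcases mul_pos_iff.1 hs with ⟨h1, h2⟩ | ⟨h1, h2⟩
    · rw [abs_of_pos h1, abs_of_pos h2] at hss
      nlinarith [neg_of_mul_neg_right ht h2.le]
    · rw [abs_of_neg h1, abs_of_neg h2] at hss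
      have : 0 < t := by nlinarith
      nlinarith
  nlinarith [mul_le_mul_of_nonneg_left h2 hc]

lemma mul_self_pos_trans {a b c : ℝ} (h : 0 < a * b) (h' : 0 < b * c) : 0 < a * c := by
  rcases mul_pos_iff.1 h with ⟨_, _⟩ | ⟨_, _⟩ <;> rcases mul_pos_iff.1 h' with ⟨_, _⟩ | ⟨_, _⟩
  · positivity
  · linarith
  · linarith
  · exact mul_pos_of_neg_of_neg ‹_› ‹_›

/-- If a point matched in a small sector precedes a point matched in a big sector on a blue
half-line, then exchanging such a pair improves the matching. -/
lemma exists_better_of_inversion {ι : Type*} [Fintype ι] {β ρ : ι → ℝ} {c : ℝ}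
    (hβ : Function.Injective β) (hc : 0 ≤ c) (hc2 : 1 / 2 ≤ c ^ 2)
    {π : Equiv.Perm ι} (hπ : NonCrossing β ρ π) {i₀ j₀ : ι}
    (h₀ : 0 < β (π i₀) * β (π j₀) ∧ |β (π i₀)| < |β (π j₀)| ∧ 0 < β (π i₀) * ρ i₀ ∧
      β (π j₀) * ρ j₀ < 0) :
    ∃ π' : Equiv.Perm ι, NonCrossing β ρ π' ∧
      (∀ k, ∃ l, sqLen c (β (π' k)) (ρ k) ≤ sqLen c (β (π l)) (ρ l)) ∧
      bigWeight β ρ π' < bigWeight β ρ π := by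
  classical
  obtain ⟨⟨i, j⟩, hij, hmin⟩ := (Set.toFinite {q : ι × ι | 0 < β (π q.1) * β (π q.2) ∧
    |β (π q.1)| < |β (π q.2)| ∧ 0 < β (π q.1) * ρ q.1 ∧ β (π q.2) * ρ q.2 < 0}).exists_minimalFor
      (fun q => |β (π q.2)| - |β (π q.1)|) _ ⟨(i₀, j₀), h₀⟩
  obtain ⟨hs, hlt, hi, hj⟩ := hij
  have hmin' : ∀ k l, 0 < β (π k) * β (π l) → |β (π k)| < |β (π l)| → 0 < β (π k) * ρ k →
      β (π l) * ρ l < 0 → |β (π j)| - |β (π i)| ≤ |β (π l)| - |β (π k)| := by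
    intro k l h1 h2 h3 h4
    by_contra! h
    exact absurd (hmin (j := (k, l)) ⟨h1, h2, h3, h4⟩ h.le) (not_le.2 h)
  have hne : i ≠ j := by rintro rfl; exact lt_irrefl _ hlt
  have hρ : ρ i * ρ j < 0 := by
    rcases mul_pos_iff.1 hs with ⟨h1, h2⟩ | ⟨h1, h2⟩
    · exact mul_neg_of_pos_of_neg (by nlinarith) (by nlinarith)
    · exact mul_neg_of_neg_of_pos (by nlinarith) (by nlinarith)
  have habs : ∀ k l, k ≠ l → 0 < β (π k) * β (π l) → |β (π k)| ≠ |β (π l)| := by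
    intro k l hkl h1 h2
    rcases abs_eq_abs.1 h2 with h | h
    · exact hkl (π.injective (hβ h))
    · rw [h] at h1; nlinarith [sq_nonneg (β (π l))]
  have hs' := hs
  rw [mul_comm] at hs'
  have hji : 0 < β (π j) * ρ i := mul_self_pos_trans hs' hi
  have hij : β (π i) * ρ j < 0 := by
    have := mul_self_pos_trans hs (c := -ρ j) (by linarith)
    linarith
  have hcross_i : ∀ l, l ≠ i → l ≠ j → ¬ Cross (β (π j)) (ρ i) (β (π l)) (ρ l) := by
    rintro l hli hlj ⟨h1, h2, h3⟩
    have h4 := mul_self_pos_trans hs h1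
    have h5 : 0 < β (π l) * ρ l := by
      rw [mul_comm] at h1
      exact mul_self_pos_trans h1 (mul_self_pos_trans hji h2)
    refine hπ i l hli.symm ⟨h4, h2, ?_⟩
    have h6 := habs i l hli.symm h4
    have h7 := hmin' l j (by rw [mul_comm]; exact h1)
    rcases mul_neg_iff.1 h3 with ⟨h8, h9⟩ | ⟨h8, h9⟩
    · refine mul_neg_of_pos_of_neg ?_ h9
      have := h7 (by linarith) h5 hj
      exact sub_pos.2 (lt_of_le_of_ne (by linarith) h6.symm)
    · exact mul_neg_of_neg_of_pos (by linarith) h9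
  have hcross_j : ∀ l, l ≠ i → l ≠ j → ¬ Cross (β (π i)) (ρ j) (β (π l)) (ρ l) := by
    rintro l hli hlj ⟨h1, h2, h3⟩
    have h4 := mul_self_pos_trans hs' h1
    have h5 : β (π l) * ρ l < 0 := by
      rw [mul_comm] at h1
      have := mul_self_pos_trans h1 (mul_self_pos_trans (c := -ρ l) (b := -ρ j)
        (by linarith) (by linarith))
      linarith
    refine hπ j l hlj.symm ⟨h4, h2, ?_⟩
    have h6 := habs j l hlj.symm h4
    have h7 := hmin' i l h1
    rcases mul_neg_iff.1 h3 with ⟨h8, h9⟩ | ⟨h8, h9⟩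
    · exact mul_neg_of_pos_of_neg (by linarith) h9
    · refine mul_neg_of_neg_of_pos ?_ h9
      have := h7 (by linarith) hi h5
      exact sub_neg.2 (lt_of_le_of_ne (by linarith) h6)
  have hi' : (π * Equiv.swap i j) i = π j := by simp
  have hj' : (π * Equiv.swap i j) j = π i := by simp
  have hk' : ∀ k, k ≠ i → k ≠ j → (π * Equiv.swap i j) k = π k := fun k h1 h2 => by
    rw [Equiv.Perm.mul_apply, Equiv.swap_apply_of_ne_of_ne h1 h2]
  refine ⟨π * Equiv.swap i j, ?_, ?_, ?_⟩
  · intro k l hkl hcr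
    by_cases hki : k = i
    · subst hki
      by_cases hlj : l = j
      · subst hlj; exact absurd hcr.2.1 (not_lt.2 hρ.le)
      · rw [hi', hk' l hkl.symm hlj] at hcr
        exact hcross_i l hkl.symm hlj hcr
    by_cases hkj : k = j
    · subst hkj
      by_cases hli : l = i
      · subst hli; exact absurd hcr.2.1 (not_lt.2 (by linarith))
      · rw [hj', hk' l hli hkl.symm] at hcr
        exact hcross_j l hli hkl.symm hcr
    rw [hk' k hki hkj] at hcr
    by_cases hli : l = i
    · subst hli
      rw [hi'] at hcr
      exact hcross_i k hki hkj hcr.symm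
    by_cases hlj : l = j
    · subst hlj
      rw [hj'] at hcr
      exact hcross_j k hki hkj hcr.symm
    rw [hk' l hli hlj] at hcr
    exact hπ k l hkl hcr
  · intro k
    by_cases hki : k = i
    · subst hki
      rw [hi']
      rcases sqLen_le_of_swap hc hc2 hs hlt hi hj with h | h
      exacts [⟨_, h⟩, ⟨_, h⟩]
    by_cases hkj : k = j
    · subst hkj
      rw [hj']
      exact ⟨k, sqLen_le_of_abs_le hc hs hlt.le hj⟩
    exact ⟨k, by rw [hk' k hki hkj]⟩
  · unfold bigWeight
    refine Finset.sum_lt_sum (fun k _ => ?_) ⟨j, Finset.mem_univ _, ?_⟩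
    · by_cases hki : k = i
      · subst hki
        rw [hi', if_neg (not_lt.2 hji.le), if_neg (not_lt.2 hi.le)]
      by_cases hkj : k = j
      · subst hkj
        rw [hj', if_pos hij, if_pos hj]
        linarith
      rw [hk' k hki hkj]
    · rw [hj', if_pos hij, if_pos hj]
      linarith

/-- Coordinate form of the main theorem. -/
lemma exists_structured_perm {ι : Type*} [Fintype ι] [Nonempty ι] {β ρ : ι → ℝ} {c : ℝ}
    (hβ : Function.Injective β) (hρ : Function.Injective ρ) (hc : 0 ≤ c) (hc2 : 1 / 2 ≤ c ^ 2) :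
    ∃ π : Equiv.Perm ι, NonCrossing β ρ π ∧
      (∀ π', NonCrossing β ρ π' →
        ∀ k, ∃ l, sqLen c (β (π k)) (ρ k) ≤ sqLen c (β (π' l)) (ρ l)) ∧
      (∀ i j, 0 < β (π i) * β (π j) → |β (π i)| < |β (π j)| → 0 < β (π i) * ρ i →
        ¬ β (π j) * ρ j < 0) ∧
      (∀ i j, 0 < ρ i * ρ j → |ρ i| < |ρ j| → 0 < β (π i) * ρ i → ¬ β (π j) * ρ j < 0) := by
  classical
  let F : Equiv.Perm ι → ℝ := fun π =>
    Finset.univ.sup' Finset.univ_nonempty fun k => sqLen c (β (π k)) (ρ k)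
  have hF : ∀ π π', (∀ k, ∃ l, sqLen c (β (π k)) (ρ k) ≤ sqLen c (β (π' l)) (ρ l)) ↔
      F π ≤ F π' := by
    intro π π'
    simp only [F]
    rw [Finset.sup'_le_iff]
    simp [Finset.le_sup'_iff]
  obtain ⟨π₀, h₀⟩ := exists_nonCrossing β ρ
  obtain ⟨π, hπ, hmin⟩ := Set.exists_min_image {π | NonCrossing β ρ π}
    (fun π => toLex (F π, bigWeight β ρ π)) (Set.toFinite _) ⟨π₀, h₀⟩
  have hno : ∀ π', NonCrossing β ρ π' → F π' ≤ F π → ¬ bigWeight β ρ π' < bigWeight β ρ π := by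
    intro π' h1 h2 h3
    rcases Prod.Lex.le_iff.1 (hmin π' h1) with h | ⟨h, h'⟩
    · exact absurd h2 (not_le.2 h)
    · exact absurd h3 (not_lt.2 h')
  refine ⟨π, hπ, fun π' h' => (hF _ _).2 ?_, fun i j h1 h2 h3 h4 => ?_, fun i j h1 h2 h3 h4 => ?_⟩
  · rcases Prod.Lex.le_iff.1 (hmin π' h') with h | ⟨h, _⟩
    exacts [h.le, h.le]
  · obtain ⟨π', h5, h6, h7⟩ := exists_better_of_inversion hβ hc hc2 hπ ⟨h1, h2, h3, h4⟩
    exact hno π' h5 ((hF _ _).1 h6) h7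
  · obtain ⟨π', h5, h6, h7⟩ := exists_better_of_inversion (i₀ := π i) (j₀ := π j) hρ hc hc2
      (NonCrossing.symm hπ)
      (by simp only [Equiv.symm_apply_apply]; exact ⟨h1, h2, by linarith, by linarith⟩)
    refine hno π'.symm h5.symm ((hF _ _).1 fun k => ?_) ?_
    · obtain ⟨l, hl⟩ := h6 (π'.symm k)
      refine ⟨π.symm l, ?_⟩
      simpa [sqLen_comm] using hl
    · rw [← bigWeight_symm β ρ π, ← bigWeight_symm β ρ π'.symm]
      exact h7

lemma smul_add_smul_inj {u v : Pt} (h : det2 u v ≠ 0) {a b a' b' : ℝ}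
    (he : a • u + b • v = a' • u + b' • v) : a = a' ∧ b = b' := by
  have h0 := congrFun (congrArg WithLp.ofLp he) 0
  have h1 := congrFun (congrArg WithLp.ofLp he) 1
  simp only [PiLp.add_apply, PiLp.smul_apply, smul_eq_mul] at h0 h1
  unfold det2 at h
  constructor
  · refine mul_right_cancel₀ h ?_
    linear_combination v 1 * h0 - v 0 * h1
  · refine mul_right_cancel₀ h ?_
    linear_combination u 0 * h1 - u 1 * h0

lemma left_ne_zero_of_det2 {u v : Pt} (h : det2 u v ≠ 0) : u ≠ 0 := by
  rintro rfl; simp [det2] at h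

lemma right_ne_zero_of_det2 {u v : Pt} (h : det2 u v ≠ 0) : v ≠ 0 := by
  rintro rfl; simp [det2] at h

lemma add_smul_ne_add_smul {u v : Pt} (h : det2 u v ≠ 0) (x : Pt) {s t : ℝ} (hs : s ≠ 0) :
    x + s • u ≠ x + t • v := by
  intro he
  have := smul_add_smul_inj h (a := s) (b := 0) (a' := 0) (b' := t)
    (by simpa using add_left_cancel he)
  exact hs this.1

lemma add_smul_inj {u : Pt} (hu : u ≠ 0) (x : Pt) {s t : ℝ} :
    x + s • u = x + t • u ↔ s = t := by
  rw [add_right_inj]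
  exact (smul_left_injective ℝ hu).eq_iff

lemma mem_segment_iff {x u v y : Pt} {s t : ℝ} :
    y ∈ segment ℝ (x + t • v) (x + s • u) ↔
      ∃ a b : ℝ, 0 ≤ a ∧ 0 ≤ b ∧ a + b = 1 ∧ x + ((b * s) • u + (a * t) • v) = y := by
  have key : ∀ a b : ℝ, a + b = 1 →
      a • (x + t • v) + b • (x + s • u) = x + ((b * s) • u + (a * t) • v) := by
    intro a b h
    obtain rfl : b = 1 - a := by linarith
    module
  constructor
  · rintro ⟨a, b, ha, hb, hab, h⟩
    exact ⟨a, b, ha, hb, hab, by rw [← h, key a b hab]⟩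
  · rintro ⟨a, b, ha, hb, hab, h⟩
    exact ⟨a, b, ha, hb, hab, by rw [← h, key a b hab]⟩

lemma segment_inter_eq_empty_iff {x u v : Pt} (h : det2 u v ≠ 0) {s t s' t' : ℝ} (hs : s ≠ 0)
    (ht : t ≠ 0) (hs' : s' ≠ 0) (ht' : t' ≠ 0) (hss : s ≠ s') (htt : t ≠ t') :
    segment ℝ (x + t • v) (x + s • u) ∩ segment ℝ (x + t' • v) (x + s' • u) = ∅ ↔
      ¬ Cross s t s' t' := by
  constructor
  · rintro he ⟨h1, h2, h3⟩
    obtain ⟨k, hk, rfl⟩ : ∃ k : ℝ, 0 < k ∧ s' = k * s :=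
      ⟨s' / s, by rw [← mul_div_mul_left _ _ hs]; exact div_pos h1 (mul_self_pos.2 hs),
        by field_simp⟩
    obtain ⟨m, hm, rfl⟩ : ∃ m : ℝ, 0 < m ∧ t' = m * t :=
      ⟨t' / t, by rw [← mul_div_mul_left _ _ ht]; exact div_pos h2 (mul_self_pos.2 ht),
        by field_simp⟩
    have h4 : (1 - k) * (1 - m) < 0 := by
      rw [abs_mul, abs_mul, abs_of_pos hk, abs_of_pos hm] at h3
      have : 0 < |s| * |t| := by positivity
      by_contra! h5
      nlinarith [mul_nonneg h5 this.le]
    obtain ⟨hd, ha, hb, ha', hb'⟩ : k - m ≠ 0 ∧ 0 ≤ m * (k - 1) / (k - m) ∧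
        0 ≤ k * (1 - m) / (k - m) ∧ 0 ≤ (k - 1) / (k - m) ∧ 0 ≤ (1 - m) / (k - m) := by
      rcases mul_neg_iff.1 h4 with ⟨h5, h6⟩ | ⟨h5, h6⟩
      · refine ⟨by linarith, ?_, ?_, ?_, ?_⟩ <;>
          refine div_nonneg_of_nonpos (by nlinarith) (by linarith)
      · refine ⟨by linarith, ?_, ?_, ?_, ?_⟩ <;>
          refine div_nonneg (by nlinarith) (by linarith)
    have hmem : x + ((k * (1 - m) / (k - m) * s) • u + (m * (k - 1) / (k - m) * t) • v) ∈
        segment ℝ (x + t • v) (x + s • u) ∩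
          segment ℝ (x + (m * t) • v) (x + (k * s) • u) := by
      refine ⟨mem_segment_iff.2 ⟨_, _, ha, hb, ?_, rfl⟩,
        mem_segment_iff.2 ⟨_, _, ha', hb', ?_, ?_⟩⟩
      · field_simp; ring
      · field_simp; ring
      · congr 3 <;> ring
    rw [he] at hmem
    exact hmem
  · intro hc
    rw [Set.eq_empty_iff_forall_notMem]
    rintro y ⟨hy, hy'⟩
    obtain ⟨a, b, ha, hb, hab, rfl⟩ := mem_segment_iff.1 hy
    obtain ⟨a', b', ha', hb', hab', he⟩ := mem_segment_iff.1 hy'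
    obtain ⟨e1, e2⟩ := smul_add_smul_inj h (add_left_cancel he)
    have hne : ∀ {p q p' q' z z' w w' : ℝ}, p + q = 1 → p' + q' = 1 → z ≠ 0 → w ≠ w' →
        q' * z = q * z' → p' * w = p * w' → q ≠ 0 := by
      rintro p q p' q' z z' w w' h1 h2 hz hw h3 h4 rfl
      obtain rfl : q' = 0 := (mul_eq_zero.1 (h3.trans (zero_mul _))).resolve_right hz
      exact hw (by linear_combination h4 - w * h2 + w' * h1)
    have hb0 : 0 < b := hb.lt_of_ne' (hne hab hab' hs' htt.symm e1 e2)
    have hb0' : 0 < b' := hb'.lt_of_ne' (hne hab' hab hs htt e1.symm e2.symm)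
    have ha0 : 0 < a := ha.lt_of_ne' (hne ((add_comm _ _).trans hab)
      ((add_comm _ _).trans hab') ht' hss.symm e2 e1)
    have ha0' : 0 < a' := ha'.lt_of_ne' (hne ((add_comm _ _).trans hab')
      ((add_comm _ _).trans hab) ht hss e2.symm e1.symm)
    have hpos : ∀ {q q' z z' : ℝ}, 0 < q → 0 < q' → z ≠ 0 → q' * z' = q * z → 0 < z * z' := by
      intro q q' z z' h1 h2 hz h3
      have : 0 < q' * (z * z') := by
        rw [mul_left_comm, h3, mul_left_comm]
        exact mul_pos h1 (mul_self_pos.2 hz)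
      exact pos_of_mul_pos_right this h2.le
    have habs : ∀ {q q' z z' : ℝ}, 0 < q → 0 < q' → q' * z' = q * z → q' * |z'| = q * |z| := by
      intro q q' z z' h1 h2 h3
      rw [← abs_of_pos h1, ← abs_of_pos h2, ← abs_mul, ← abs_mul, h3]
    refine hc ⟨hpos hb0 hb0' hs e1, hpos ha0 ha0' ht e2, ?_⟩
    have hbb : b' - b ≠ 0 := by
      intro h0
      obtain rfl : b' = b := by linarith
      exact hss (mul_left_cancel₀ hb0'.ne' e1.symm)
    have e3 := habs hb0 hb0' e1
    have e4 := habs ha0 ha0' e2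
    have e5 : a' * b' * ((|s| - |s'|) * (|t| - |t'|)) = -(|s| * |t| * (b' - b) ^ 2) := by
      obtain rfl : a = 1 - b := by linarith
      obtain rfl : a' = 1 - b' := by linarith
      linear_combination -(|t| - |t'|) * (1 - b') * e3 - |s| * (b' - b) * e4
    have e6 : 0 < |s| * |t| * (b' - b) ^ 2 := by positivity
    by_contra! h0
    nlinarith [mul_nonneg (mul_pos ha0' hb0').le h0]

lemma add_smul_mem_halfLine_iff {u : Pt} (hu : u ≠ 0) (x : Pt) {s ε : ℝ}
    (hε : ε = 1 ∨ ε = -1) : x + s • u ∈ halfLine x (ε • u) ↔ 0 < ε * s := by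
  have hεε : ε * ε = 1 := by rcases hε with rfl | rfl <;> norm_num
  unfold halfLine
  simp only [Set.mem_ofPred_eq, smul_smul, add_smul_inj hu]
  constructor
  · rintro ⟨t, ht, rfl⟩
    rw [mul_left_comm, hεε]
    linarith
  · intro h
    exact ⟨ε * s, h, by linear_combination -s * hεε⟩

lemma inSmallSector_iff {u v : Pt} (h : det2 u v ≠ 0) (hc : 0 < ⟪u, v⟫_ℝ) (x : Pt) {s t : ℝ} :
    InSmallSector x u v (x + s • u) (x + t • v) ↔ 0 < s * t := by
  unfold InSmallSector
  constructor
  · rintro ⟨ε, δ, hε, hδ, hi, hs, ht⟩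
    rw [add_smul_mem_halfLine_iff (left_ne_zero_of_det2 h) x hε] at hs
    rw [add_smul_mem_halfLine_iff (right_ne_zero_of_det2 h) x hδ] at ht
    rw [real_inner_smul_left, real_inner_smul_right] at hi
    rcases hε with rfl | rfl <;> rcases hδ with rfl | rfl <;> nlinarith
  · intro hst
    have : ∃ ε : ℝ, (ε = 1 ∨ ε = -1) ∧ 0 < ε * s ∧ 0 < ε * t := by
      rcases mul_pos_iff.1 hst with ⟨h1, h2⟩ | ⟨h1, h2⟩
      · exact ⟨1, by simp, by linarith, by linarith⟩
      · exact ⟨-1, by simp, by linarith, by linarith⟩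
    obtain ⟨ε, hε, hs, ht⟩ := this
    refine ⟨ε, ε, hε, hε, ?_, (add_smul_mem_halfLine_iff (left_ne_zero_of_det2 h) x hε).2 hs,
      (add_smul_mem_halfLine_iff (right_ne_zero_of_det2 h) x hε).2 ht⟩
    rw [real_inner_smul_left, real_inner_smul_right]
    rcases hε with rfl | rfl <;> linarith

lemma inBigSector_iff {u v : Pt} (h : det2 u v ≠ 0) (hc : 0 < ⟪u, v⟫_ℝ) (x : Pt) {s t : ℝ} :
    InBigSector x u v (x + s • u) (x + t • v) ↔ s * t < 0 := by
  unfold InBigSector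
  constructor
  · rintro ⟨ε, δ, hε, hδ, hi, hs, ht⟩
    rw [add_smul_mem_halfLine_iff (left_ne_zero_of_det2 h) x hε] at hs
    rw [add_smul_mem_halfLine_iff (right_ne_zero_of_det2 h) x hδ] at ht
    rw [real_inner_smul_left, real_inner_smul_right] at hi
    rcases hε with rfl | rfl <;> rcases hδ with rfl | rfl <;> nlinarith
  · intro hst
    have : ∃ ε : ℝ, (ε = 1 ∨ ε = -1) ∧ 0 < ε * s ∧ 0 < -ε * t := by
      rcases mul_neg_iff.1 hst with ⟨h1, h2⟩ | ⟨h1, h2⟩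
      · exact ⟨1, by simp, by linarith, by linarith⟩
      · exact ⟨-1, by simp, by linarith, by linarith⟩
    obtain ⟨ε, hε, hs, ht⟩ := this
    have hε' : -ε = 1 ∨ -ε = -1 := by rcases hε with rfl | rfl <;> simp
    refine ⟨ε, -ε, hε, hε', ?_, (add_smul_mem_halfLine_iff (left_ne_zero_of_det2 h) x hε).2 hs,
      (add_smul_mem_halfLine_iff (right_ne_zero_of_det2 h) x hε').2 ht⟩
    rw [real_inner_smul_left, real_inner_smul_right]
    rcases hε with rfl | rfl <;> linarith

lemma inSmallSector_neg_right (x u v b r : Pt) :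
    InSmallSector x u (-v) b r ↔ InSmallSector x u v b r := by
  have key : ∀ v, InSmallSector x u v b r → InSmallSector x u (-v) b r := by
    rintro v ⟨ε, δ, hε, hδ, h⟩
    exact ⟨ε, -δ, hε, by rcases hδ with rfl | rfl <;> simp, by rwa [neg_smul_neg]⟩
  exact ⟨fun h => neg_neg v ▸ key _ h, key v⟩

lemma inBigSector_neg_right (x u v b r : Pt) :
    InBigSector x u (-v) b r ↔ InBigSector x u v b r := by
  have key : ∀ v, InBigSector x u v b r → InBigSector x u (-v) b r := by
    rintro v ⟨ε, δ, hε, hδ, h⟩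
    exact ⟨ε, -δ, hε, by rcases hδ with rfl | rfl <;> simp, by rwa [neg_smul_neg]⟩
  exact ⟨fun h => neg_neg v ▸ key _ h, key v⟩

lemma dist_eq_sqrt_sqLen {u v : Pt} (hu : ‖u‖ = 1) (hv : ‖v‖ = 1) (x : Pt) (s t : ℝ) :
    dist (x + t • v) (x + s • u) = √(sqLen ⟪u, v⟫_ℝ s t) := by
  rw [dist_add_left, dist_comm, dist_eq_norm, ← Real.sqrt_sq (norm_nonneg (s • u - t • v)),
    norm_sub_sq_real, real_inner_smul_left, real_inner_smul_right, norm_smul, norm_smul, hu, hv,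
    mul_one, mul_one, Real.norm_eq_abs, Real.norm_eq_abs, sq_abs, sq_abs, sqLen]
  congr 1
  ring

lemma dist_add_smul_self {u : Pt} (hu : ‖u‖ = 1) (x : Pt) (s : ℝ) :
    dist x (x + s • u) = |s| := by
  rw [dist_self_add_right, norm_smul, hu, mul_one, Real.norm_eq_abs]

lemma isBM_iff_nonCrossing {ι : Type*} [Finite ι] {x u v : Pt} (h : det2 u v ≠ 0) {β ρ : ι → ℝ}
    (hβ : Function.Injective β) (hρ : Function.Injective ρ) (hβ0 : ∀ i, β i ≠ 0)
    (hρ0 : ∀ i, ρ i ≠ 0) {B R : Finset Pt} (hB : (B : Set Pt) = Set.range fun i => x + β i • u)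
    (hR : (R : Set Pt) = Set.range fun i => x + ρ i • v) {σ : Pt → Pt} {π : Equiv.Perm ι}
    (hσ : ∀ i, σ (x + ρ i • v) = x + β (π i) • u) :
    IsBM B R σ ↔ NonCrossing β ρ π := by
  have hR' : ∀ r, r ∈ R ↔ ∃ i, x + ρ i • v = r := fun r => by
    rw [← Finset.mem_coe, hR, Set.mem_range]
  have hbij : Set.BijOn σ R B := by
    rw [hB, hR]
    refine ⟨?_, ?_, ?_⟩
    · rintro _ ⟨i, rfl⟩
      exact ⟨π i, (hσ i).symm⟩
    · rintro _ ⟨i, rfl⟩ _ ⟨j, rfl⟩ hij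
      simp only [hσ, add_smul_inj (left_ne_zero_of_det2 h)] at hij
      rw [π.injective (hβ hij)]
    · rintro _ ⟨i, rfl⟩
      exact ⟨_, ⟨π.symm i, rfl⟩, by simp [hσ]⟩
  unfold IsBM NonCrossing
  rw [and_iff_right hbij]
  have key : ∀ i j, i ≠ j →
      (segment ℝ (x + ρ i • v) (σ (x + ρ i • v)) ∩ segment ℝ (x + ρ j • v) (σ (x + ρ j • v)) = ∅
        ↔ ¬ Cross (β (π i)) (ρ i) (β (π j)) (ρ j)) := fun i j hij => by
    rw [hσ, hσ]
    exact segment_inter_eq_empty_iff h (hβ0 _) (hρ0 _) (hβ0 _) (hρ0 _)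
      (fun e => hij (π.injective (hβ e))) (fun e => hij (hρ e))
  constructor
  · intro H i j hij
    exact (key i j hij).1 (H _ ((hR' _).2 ⟨i, rfl⟩) _ ((hR' _).2 ⟨j, rfl⟩)
      fun e => hij (hρ ((add_smul_inj (right_ne_zero_of_det2 h) x).1 e)))
  · intro H r hr r' hr' hrr
    obtain ⟨i, rfl⟩ := (hR' _).1 hr
    obtain ⟨j, rfl⟩ := (hR' _).1 hr'
    have hij : i ≠ j := by rintro rfl; exact hrr rfl
    exact (key i j hij).2 (H i j hij)

lemma exists_perm_of_bijOn {ι : Type*} [Finite ι] {x u v : Pt} {β ρ : ι → ℝ}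
    (hρ : Function.Injective fun i => x + ρ i • v) {B R : Finset Pt}
    (hB : (B : Set Pt) = Set.range fun i => x + β i • u)
    (hR : (R : Set Pt) = Set.range fun i => x + ρ i • v) {σ : Pt → Pt}
    (hσ : Set.BijOn σ R B) :
    ∃ π : Equiv.Perm ι, ∀ i, σ (x + ρ i • v) = x + β (π i) • u := by
  have hmem : ∀ i, x + ρ i • v ∈ (R : Set Pt) := fun i => hR ▸ Set.mem_range_self i
  have hex : ∀ i, ∃ j, x + β j • u = σ (x + ρ i • v) := fun i => by
    have := hσ.mapsTo (hmem i)
    rwa [hB] at this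
  choose f hf using hex
  have hinj : Function.Injective f := fun i j hij =>
    hρ (hσ.injOn (hmem i) (hmem j) (by rw [← hf, ← hf, hij]))
  exact ⟨Equiv.ofBijective f (Finite.injective_iff_bijective.1 hinj), fun i => (hf i).symm⟩

/-- A finite set of points of a line, indexed by coordinates. -/
lemma exists_coordinates {n : ℕ} {x u : Pt} {B : Finset Pt}
    (hB : ∀ b ∈ B, ∃ t : ℝ, t ≠ 0 ∧ b = x + t • u) (hcB : B.card = n) :
    ∃ β : Fin n → ℝ, Function.Injective β ∧ (∀ i, β i ≠ 0) ∧
      (B : Set Pt) = Set.range fun i => x + β i • u := by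
  have e := (B.equivFinOfCardEq hcB).symm
  choose β hβ0 hβ using fun i => hB (e i) (e i).2
  refine ⟨β, fun i j hij => e.injective (Subtype.ext ?_), hβ0, ?_⟩
  · rw [hβ, hβ, hij]
  · ext p
    simp only [← hβ, Set.mem_range, Finset.mem_coe]
    exact ⟨fun hp => ⟨e.symm ⟨p, hp⟩, by simp⟩, by rintro ⟨i, rfl⟩; exact (e i).2⟩

lemma exists_edge_iff {ι : Type*} {x u v : Pt} (h : det2 u v ≠ 0) {β ρ : ι → ℝ}
    (hβ : Function.Injective β) (hρ : Function.Injective ρ) (hβ0 : ∀ i, β i ≠ 0)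
    {R : Finset Pt} (hR : (R : Set Pt) = Set.range fun i => x + ρ i • v) {σ : Pt → Pt}
    {π : Equiv.Perm ι} (hσ : ∀ i, σ (x + ρ i • v) = x + β (π i) • u) (Q : Pt → Pt → Prop)
    {p : Pt} {i : ι} (hp : p = x + ρ i • v ∨ p = x + β (π i) • u) :
    (∃ r ∈ R, (p = r ∨ p = σ r) ∧ Q (σ r) r) ↔ Q (x + β (π i) • u) (x + ρ i • v) := by
  constructor
  · rintro ⟨r, hr, hpr, hQ⟩
    rw [← Finset.mem_coe, hR] at hr
    obtain ⟨j, rfl⟩ := hr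
    simp only [hσ] at hpr hQ
    suffices j = i by rwa [this] at hQ
    rcases hp with rfl | rfl <;> rcases hpr with e | e
    · exact (hρ ((add_smul_inj (right_ne_zero_of_det2 h) x).1 e)).symm
    · exact absurd e.symm (add_smul_ne_add_smul h x (hβ0 _))
    · exact absurd e (add_smul_ne_add_smul h x (hβ0 _))
    · exact (π.injective (hβ ((add_smul_inj (left_ne_zero_of_det2 h) x).1 e))).symm
  · intro hQ
    refine ⟨x + ρ i • v, ?_, by rw [hσ]; exact hp, by rwa [hσ]⟩
    rw [← Finset.mem_coe, hR]
    exact Set.mem_range_self i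

lemma structured_optimum_of_inner_pos {n : ℕ} (hn : 1 ≤ n)
    {x u v : Pt} (hu : ‖u‖ = 1) (hv : ‖v‖ = 1) (hnp : det2 u v ≠ 0)
    (hangle : Real.cos (Real.pi / 4) ≤ ⟪u, v⟫_ℝ) {B R : Finset Pt}
    (hB : ∀ b ∈ B, ∃ t : ℝ, t ≠ 0 ∧ b = x + t • u)
    (hR : ∀ r ∈ R, ∃ t : ℝ, t ≠ 0 ∧ r = x + t • v)
    (hcB : B.card = n) (hcR : R.card = n) (hRne : R.Nonempty) :
    ∃ σ, IsBM B R σ ∧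
      (∀ σ', IsBM B R σ' →
        R.sup' hRne (fun r => dist r (σ r)) ≤ R.sup' hRne (fun r => dist r (σ' r))) ∧
      (∀ w : Pt, (w = u ∨ w = -u ∨ w = v ∨ w = -v) →
        (∀ a ∈ (↑B ∪ ↑R : Set Pt) ∩ halfLine x w,
          ∀ c ∈ (↑B ∪ ↑R : Set Pt) ∩ halfLine x w,
            dist x a ≤ dist x c → MatchedBig x u v R σ c → MatchedBig x u v R σ a) ∧
        (∀ a ∈ (↑B ∪ ↑R : Set Pt) ∩ halfLine x w,
          ∀ c ∈ (↑B ∪ ↑R : Set Pt) ∩ halfLine x w,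
            dist x a ≤ dist x c → MatchedSmall x u v R σ a → MatchedSmall x u v R σ c)) := by
  classical
  have hc2 : 1 / 2 ≤ ⟪u, v⟫_ℝ ^ 2 := by
    rw [Real.cos_pi_div_four] at hangle
    have := pow_le_pow_left₀ (by positivity) hangle 2
    rw [div_pow, Real.sq_sqrt (by norm_num)] at this
    linarith
  have hc : 0 < ⟪u, v⟫_ℝ := by
    rw [Real.cos_pi_div_four] at hangle
    exact lt_of_lt_of_le (by positivity) hangle
  obtain ⟨β, hβ, hβ0, hBβ⟩ := exists_coordinates hB hcB
  obtain ⟨ρ, hρ, hρ0, hRρ⟩ := exists_coordinates hR hcR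
  have : Nonempty (Fin n) := ⟨⟨0, hn⟩⟩
  obtain ⟨π, hπ, hopt, hblue, hred⟩ := exists_structured_perm hβ hρ hc.le hc2
  have hρ' : Function.Injective fun i => x + ρ i • v := fun i j e =>
    hρ ((add_smul_inj (right_ne_zero_of_det2 hnp) x).1 e)
  let σ : Pt → Pt := Function.extend (fun i => x + ρ i • v) (fun i => x + β (π i) • u) id
  have hσ : ∀ i, σ (x + ρ i • v) = x + β (π i) • u := fun i => hρ'.extend_apply _ _ i
  have hmR : ∀ r, r ∈ R ↔ ∃ i, x + ρ i • v = r := fun r => by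
    rw [← Finset.mem_coe, hRρ, Set.mem_range]
  have hmB : ∀ b, b ∈ B ↔ ∃ i, x + β i • u = b := fun b => by
    rw [← Finset.mem_coe, hBβ, Set.mem_range]
  refine ⟨σ, (isBM_iff_nonCrossing hnp hβ hρ hβ0 hρ0 hBβ hRρ hσ).2 hπ, fun σ' hσ' => ?_, ?_⟩
  · obtain ⟨π', hπ'⟩ := exists_perm_of_bijOn hρ' hBβ hRρ hσ'.1
    refine Finset.sup'_le _ _ fun r hr => ?_
    obtain ⟨k, rfl⟩ := (hmR r).1 hr
    obtain ⟨l, hl⟩ :=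
      hopt π' ((isBM_iff_nonCrossing hnp hβ hρ hβ0 hρ0 hBβ hRρ hπ').1 hσ') k
    refine le_trans ?_ (Finset.le_sup' _ ((hmR _).2 ⟨l, rfl⟩))
    rw [hσ, hπ', dist_eq_sqrt_sqLen hu hv, dist_eq_sqrt_sqLen hu hv]
    exact Real.sqrt_le_sqrt hl
  have hsmall : ∀ {p i}, (p = x + ρ i • v ∨ p = x + β (π i) • u) →
      (MatchedSmall x u v R σ p ↔ 0 < β (π i) * ρ i) := fun hp =>
    (exists_edge_iff hnp hβ hρ hβ0 hRρ hσ _ hp).trans (inSmallSector_iff hnp hc x)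
  have hbig : ∀ {p i}, (p = x + ρ i • v ∨ p = x + β (π i) • u) →
      (MatchedBig x u v R σ p ↔ β (π i) * ρ i < 0) := fun hp =>
    (exists_edge_iff hnp hβ hρ hβ0 hRρ hσ _ hp).trans (inBigSector_iff hnp hc x)
  have hsign : ∀ i, β (π i) * ρ i < 0 ∨ 0 < β (π i) * ρ i := fun i =>
    lt_or_gt_of_ne (mul_ne_zero (hβ0 _) (hρ0 _))
  have hstep : ∀ {a c i j}, (a = x + ρ i • v ∨ a = x + β (π i) • u) →
      (c = x + ρ j • v ∨ c = x + β (π j) • u) →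
      (0 < β (π i) * ρ i → ¬ β (π j) * ρ j < 0) →
      (MatchedBig x u v R σ c → MatchedBig x u v R σ a) ∧
        (MatchedSmall x u v R σ a → MatchedSmall x u v R σ c) := by
    intro a c i j ha hc' hij
    rw [hsmall ha, hsmall hc', hbig ha, hbig hc']
    have h1 := hsign i
    have h2 := hsign j
    tauto
  suffices H : ∀ w : Pt, (w = u ∨ w = -u ∨ w = v ∨ w = -v) →
      ∀ a ∈ (↑B ∪ ↑R : Set Pt) ∩ halfLine x w, ∀ c ∈ (↑B ∪ ↑R : Set Pt) ∩ halfLine x w,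
        dist x a ≤ dist x c → (MatchedBig x u v R σ c → MatchedBig x u v R σ a) ∧
          (MatchedSmall x u v R σ a → MatchedSmall x u v R σ c) from
    fun w hw => ⟨fun a ha c hc' h => (H w hw a ha c hc' h).1,
      fun a ha c hc' h => (H w hw a ha c hc' h).2⟩
  intro w hw a ha c hc' hac
  have hw' : (∃ ε : ℝ, (ε = 1 ∨ ε = -1) ∧ w = ε • u) ∨
      ∃ ε : ℝ, (ε = 1 ∨ ε = -1) ∧ w = ε • v := by
    rcases hw with rfl | rfl | rfl | rfl
    exacts [.inl ⟨1, by simp⟩, .inl ⟨-1, by simp⟩, .inr ⟨1, by simp⟩, .inr ⟨-1, by simp⟩]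
  have hsame : ∀ {ε s t : ℝ}, (ε = 1 ∨ ε = -1) → 0 < ε * s → 0 < ε * t → 0 < s * t := by
    rintro ε s t - hs ht
    exact mul_self_pos_trans (by rwa [mul_comm]) ht
  have hlt : ∀ {s t : ℝ}, 0 < s * t → |s| ≤ |t| → s ≠ t → |s| < |t| := by
    intro s t h1 h2 h3
    refine lt_of_le_of_ne h2 fun h4 => ?_
    rcases abs_eq_abs.1 h4 with h | h
    · exact h3 h
    · rw [h] at h1; nlinarith [sq_nonneg t]
  rcases hw' with ⟨ε, hε, rfl⟩ | ⟨ε, hε, rfl⟩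
  · have hidx : ∀ p ∈ (↑B ∪ ↑R : Set Pt) ∩ halfLine x (ε • u),
        ∃ i, p = x + β (π i) • u ∧ 0 < ε * β (π i) := by
      rintro p ⟨hp | hp, hph⟩
      · obtain ⟨i, rfl⟩ := (hmB p).1 hp
        exact ⟨π.symm i, by simp,
          by simpa using (add_smul_mem_halfLine_iff (left_ne_zero_of_det2 hnp) x hε).1 hph⟩
      · obtain ⟨i, rfl⟩ := (hmR p).1 hp
        obtain ⟨t, ht, e⟩ := hph
        rw [smul_smul] at e
        exact absurd e.symm (add_smul_ne_add_smul hnp x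
          (mul_ne_zero ht.ne' (by rcases hε with rfl | rfl <;> norm_num)))
    obtain ⟨i, rfl, hi⟩ := hidx a ha
    obtain ⟨j, rfl, hj⟩ := hidx c hc'
    rw [dist_add_smul_self hu, dist_add_smul_self hu] at hac
    refine hstep (.inr rfl) (.inr rfl) fun h1 => ?_
    by_cases hij : i = j
    · subst hij; exact not_lt.2 h1.le
    · exact hblue i j (hsame hε hi hj)
        (hlt (hsame hε hi hj) hac fun e => hij (π.injective (hβ e))) h1
  · have hidx : ∀ p ∈ (↑B ∪ ↑R : Set Pt) ∩ halfLine x (ε • v),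
        ∃ i, p = x + ρ i • v ∧ 0 < ε * ρ i := by
      rintro p ⟨hp | hp, hph⟩
      · obtain ⟨i, rfl⟩ := (hmB p).1 hp
        obtain ⟨t, ht, e⟩ := hph
        rw [smul_smul] at e
        exact absurd e (add_smul_ne_add_smul hnp x (hβ0 i))
      · obtain ⟨i, rfl⟩ := (hmR p).1 hp
        exact ⟨i, rfl, (add_smul_mem_halfLine_iff (right_ne_zero_of_det2 hnp) x hε).1 hph⟩
    obtain ⟨i, rfl, hi⟩ := hidx a ha
    obtain ⟨j, rfl, hj⟩ := hidx c hc'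
    rw [dist_add_smul_self hv, dist_add_smul_self hv] at hac
    refine hstep (.inl rfl) (.inl rfl) fun h1 => ?_
    by_cases hij : i = j
    · subst hij; exact not_lt.2 h1.le
    · exact hred i j (hsame hε hi hj)
        (hlt (hsame hε hi hj) hac fun e => hij (hρ e)) h1

/-- Let `P = B ∪ R` be a doubly collinear point set with `|B| = |R| = n ≥ 1`
whose two (non-parallel) lines meet at an acute angle of at most `π/4`. Then there exists a
bichromatic perfect non-crossing matching minimizing the maximum edge length such that, on each
of the four half-lines, the points matched through a big sector form an initial segment (the
points closest to `x`) of the ordering by distance to `x`, and the points matched through a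
small sector form the complementary final segment. -/
theorem dc_small_angle_structured_optimum (n : ℕ) (hn : 1 ≤ n)
    (x u v : Pt) (hu : ‖u‖ = 1) (hv : ‖v‖ = 1) (hnp : det2 u v ≠ 0)
    (hangle : Real.cos (Real.pi / 4) ≤ |⟪u, v⟫_ℝ|) (B R : Finset Pt)
    (hB : ∀ b ∈ B, ∃ t : ℝ, t ≠ 0 ∧ b = x + t • u)
    (hR : ∀ r ∈ R, ∃ t : ℝ, t ≠ 0 ∧ r = x + t • v)
    (hcB : B.card = n) (hcR : R.card = n) (hRne : R.Nonempty) :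
    ∃ σ, IsBM B R σ ∧
      (∀ σ', IsBM B R σ' →
        R.sup' hRne (fun r => dist r (σ r)) ≤ R.sup' hRne (fun r => dist r (σ' r))) ∧
      (∀ w : Pt, (w = u ∨ w = -u ∨ w = v ∨ w = -v) →
        (∀ a ∈ (↑B ∪ ↑R : Set Pt) ∩ halfLine x w,
          ∀ c ∈ (↑B ∪ ↑R : Set Pt) ∩ halfLine x w,
            dist x a ≤ dist x c → MatchedBig x u v R σ c → MatchedBig x u v R σ a) ∧
        (∀ a ∈ (↑B ∪ ↑R : Set Pt) ∩ halfLine x w,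
          ∀ c ∈ (↑B ∪ ↑R : Set Pt) ∩ halfLine x w,
            dist x a ≤ dist x c → MatchedSmall x u v R σ a → MatchedSmall x u v R σ c)) := by
  rcases le_abs.1 hangle with h | h
  · exact structured_optimum_of_inner_pos hn hu hv hnp h hB hR hcB hcR hRne
  · have hnp' : det2 u (-v) ≠ 0 := by
      have : det2 u (-v) = -det2 u v := by simp only [det2, PiLp.neg_apply]; ring
      rw [this]; exact neg_ne_zero.2 hnp
    obtain ⟨σ, h1, h2, h3⟩ := structured_optimum_of_inner_pos hn (x := x) hu (v := -v)
      (by rwa [norm_neg]) hnp' (by rwa [inner_neg_right]) hB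
      (fun r hr => by
        obtain ⟨t, ht, e⟩ := hR r hr
        exact ⟨-t, neg_ne_zero.2 ht, by rw [e, neg_smul_neg]⟩) hcB hcR hRne
    refine ⟨σ, h1, h2, fun w hw => ?_⟩
    have := h3 w (by rw [neg_neg]; tauto)
    simpa only [MatchedBig, MatchedSmall, inBigSector_neg_right, inSmallSector_neg_right]
      using this
end
end
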